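/- arXiv:2008.08263 — 3 statements merged into one kernel-verified Lean document; each statement's English description precedes it below -/
import Mathlib

section
/- Let Ω ⊂ ℝⁿ be a bounded open set and suppose the Orlicz–Sobolev inequality ‖w‖_{L^φ(Ω,dμ)} ≤ C₀ (∫_Ω |∇_A w|² dμ)^{1/2} holds for every pair (w, ∇_A w) ∈ (W_A^{1,2})₀(Ω), where φ is a Young function satisfying φ(t) ≥ t² for all t ≥ 0 and φ(t) ≥ t²(ln t)^N for all t ≥ 1, for some N > 1. Assume moreover that (W_A^{1,2})₀(Ω) is stable under truncation: for every (u,G) ∈ (W_A^{1,2})₀(Ω), every sign ε ∈ {+1,−1} and every constant c ≥ 0, the pair ((εu − c)₊, 1_{εu>c} εG) also belongs to (W_A^{1,2})₀(Ω). Then for every f ∈ L^∞(Ω) there exists a pair (u, ∇_A u) ∈ (W_A^{1,2})₀(Ω), unique as a pair, such that u is a weak solution of ∇·A∇u = f in Ω, and this solution satisfies ess sup_Ω |u| ≤ C‖f‖_{L^∞(Ω)} for a constant C independent of f. -/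
open MeasureTheory Filter Topology Set Matrix ENNReal NNReal

noncomputable section

/-- Vectors in `ℝⁿ`. -/
abbrev Vec (n : ℕ) := Fin n → ℝ

/-- The (pointwise) gradient of a real valued function on `ℝⁿ`, via `fderiv`
(junk value `0` at points of non-differentiability). -/
noncomputable def grad {n : ℕ} (w : Vec n → ℝ) (x : Vec n) : Vec n :=
  fun i => fderiv ℝ w x (Pi.single i 1)

/-- The `A`-gradient `∇_A w = B ∇w`, where `A = BᵀB`. -/
noncomputable def Agrad {n : ℕ} (Bm : Vec n → Matrix (Fin n) (Fin n) ℝ)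
    (w : Vec n → ℝ) (x : Vec n) : Vec n :=
  (Bm x) *ᵥ (grad w x)

/-- Lipschitz function with compact support contained in `Ω`. -/
def IsLipCpt {n : ℕ} (Ω : Set (Vec n)) (w : Vec n → ℝ) : Prop :=
  (∃ L, LipschitzWith L w) ∧ HasCompactSupport w ∧ tsupport w ⊆ Ω

/-- Squared euclidean norm of a vector in `ℝⁿ`. -/
noncomputable def sqNorm {n : ℕ} (v : Vec n) : ℝ := ∑ i, (v i) ^ 2

/-- Squared `L²(Ω)` distance of two scalar functions. -/
noncomputable def l2dist {n : ℕ} (Ω : Set (Vec n)) (f g : Vec n → ℝ) : ℝ≥0∞ :=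
  ∫⁻ x in Ω, ENNReal.ofReal ((f x - g x) ^ 2)

/-- Squared `L²(Ω;ℝⁿ)` distance of two vector valued functions. -/
noncomputable def l2distV {n : ℕ} (Ω : Set (Vec n)) (F G : Vec n → Vec n) : ℝ≥0∞ :=
  ∫⁻ x in Ω, ENNReal.ofReal (sqNorm (fun i => F x i - G x i))

/-- The pair `(u, G)` belongs to the degenerate Sobolev space `(W_A^{1,2})₀(Ω)`:
`u ∈ L²(Ω)`, `G ∈ L²(Ω;ℝⁿ)` and there are compactly supported Lipschitz functions `w k`
with `w k → u` in `L²(Ω)` and `B ∇(w k) → G` in `L²(Ω;ℝⁿ)`. -/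
def MemW12zero {n : ℕ} (Ω : Set (Vec n)) (Bm : Vec n → Matrix (Fin n) (Fin n) ℝ)
    (u : Vec n → ℝ) (G : Vec n → Vec n) : Prop :=
  AEMeasurable u (volume.restrict Ω) ∧ AEMeasurable G (volume.restrict Ω) ∧
  (∫⁻ x in Ω, ENNReal.ofReal ((u x) ^ 2)) < ⊤ ∧
  (∫⁻ x in Ω, ENNReal.ofReal (sqNorm (G x))) < ⊤ ∧
  ∃ w : ℕ → Vec n → ℝ,
    (∀ k, IsLipCpt Ω (w k)) ∧
    Tendsto (fun k => l2dist Ω (w k) u) atTop (𝓝 0) ∧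
    Tendsto (fun k => l2distV Ω (fun x => Agrad Bm (w k) x) G) atTop (𝓝 0)

/-- `u` (with `A`-gradient `G`) is a weak solution of `∇·A∇u = f` in `Ω`. -/
def IsWeakSol {n : ℕ} (Ω : Set (Vec n)) (Bm : Vec n → Matrix (Fin n) (Fin n) ℝ)
    (f u : Vec n → ℝ) (G : Vec n → Vec n) : Prop :=
  MemW12zero Ω Bm u G ∧
  ∀ φ : Vec n → ℝ, IsLipCpt Ω φ →
    (∫ x in Ω, ∑ i, G x i * Agrad Bm φ x i) = - ∫ x in Ω, f x * φ x

/-- `B` is a bounded Lipschitz matrix valued function. -/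
def BoundedLipMatrix {n : ℕ} (Bm : Vec n → Matrix (Fin n) (Fin n) ℝ) : Prop :=
  (∃ M : ℝ, ∀ x i j, |Bm x i j| ≤ M) ∧
  (∃ L : NNReal, ∀ i j, LipschitzWith L (fun x => Bm x i j))

/-- The normalized measure `dμ = dx/|Ω|` on `Ω`. -/
noncomputable def normMeasure {n : ℕ} (Ω : Set (Vec n)) : Measure (Vec n) :=
  (volume Ω)⁻¹ • volume.restrict Ω

/-- The convex conjugate (Legendre transform) `θ̃(t) = sup_s (st − θ(s))` of a
`[0,∞]`-valued function, computed with truncated subtraction in `[0,∞]`. -/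
noncomputable def youngConj (θ : ℝ → ℝ≥0∞) (t : ℝ) : ℝ≥0∞ :=
  ⨆ s : ℝ, ENNReal.ofReal (s * t) - θ s

/-- `θ : ℝ → [0,∞]` is a Young function. -/
structure IsYoung (θ : ℝ → ℝ≥0∞) : Prop where
  convex : ∀ x y a b : ℝ, 0 ≤ a → 0 ≤ b → a + b = 1 →
    θ (a * x + b * y) ≤ ENNReal.ofReal a * θ x + ENNReal.ofReal b * θ y
  lsc : LowerSemicontinuous θ
  even : ∀ t, θ (-t) = θ t
  zero : θ 0 = 0
  nontrivial : ∃ t > 0, θ t ≠ 0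
  conj_nontrivial : ∃ t > 0, youngConj θ t ≠ 0

/-- The Luxemburg norm `‖f‖_{L^θ(μ)} = inf {k > 0 : ∫ θ(f/k) dμ ≤ 1}`, with `inf ∅ = ∞`. -/
noncomputable def luxNorm {α : Type*} [MeasurableSpace α] (θ : ℝ → ℝ≥0∞)
    (μ : Measure α) (f : α → ℝ) : ℝ≥0∞ :=
  sInf (ENNReal.ofReal '' {k : ℝ | 0 < k ∧ ∫⁻ x, θ (f x / k) ∂μ ≤ 1})

/-- The Orlicz bump function `Φ_N`: `Φ_N(t) = t (ln t)^N` for `t ≥ e^{2N}` and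
`Φ_N(t) = (2N)^N t` for `0 ≤ t ≤ e^{2N}`, extended evenly. -/
noncomputable def orliczBump (N : ℝ) (t : ℝ) : ℝ≥0∞ :=
  if |t| ≤ Real.exp (2 * N) then ENNReal.ofReal ((2 * N) ^ N * |t|)
  else ENNReal.ofReal (|t| * Real.log |t| ^ N)

end

lemma laxMilgram_aux {H1 H2 : Type*} [NormedAddCommGroup H1] [InnerProductSpace ℝ H1]
    [CompleteSpace H1] [NormedAddCommGroup H2] [InnerProductSpace ℝ H2] [CompleteSpace H2]
    (V : Submodule ℝ (WithLp 2 (H1 × H2))) (hV : IsClosed (V : Set (WithLp 2 (H1 × H2))))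
    (C : ℝ) (hC : ∀ p ∈ V, ‖p.fst‖ ≤ C * ‖p.snd‖) (f : H1) :
    ∃ p ∈ V, ∀ q ∈ V, inner ℝ p.snd q.snd = - inner ℝ f q.fst := by
  have : CompleteSpace V := hV.completeSpace_coe
  let T : V →L[ℝ] H2 := (WithLp.sndL 2 ℝ H1 H2).comp V.subtypeL
  let S : V →L[ℝ] H1 := (WithLp.fstL 2 ℝ H1 H2).comp V.subtypeL
  let Bf : V →L[ℝ] V →L[ℝ] ℝ := (innerSL ℝ (E := H2)).bilinearComp T T
  have hco : IsCoercive Bf := by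
    refine ⟨(C ^ 2 + 1)⁻¹, by positivity, ?_⟩
    intro p
    have h1 : ‖p‖ ^ 2 = ‖p.1.fst‖ ^ 2 + ‖p.1.snd‖ ^ 2 := by
      rw [← WithLp.prod_norm_sq_eq_of_L2]; rfl
    have h2 := hC p.1 p.2
    have h3 : Bf p p = ‖p.1.snd‖ ^ 2 := by
      change inner ℝ p.1.snd p.1.snd = _
      exact real_inner_self_eq_norm_sq _
    rw [h3, mul_assoc, ← pow_two, h1, inv_mul_le_iff₀ (by positivity)]
    have : ‖p.1.fst‖ ^ 2 ≤ (C * ‖p.1.snd‖) ^ 2 := by gcongr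
    nlinarith
  let l : StrongDual ℝ V := -((innerSL ℝ f).comp S)
  let p : V := hco.continuousLinearEquivOfBilin.symm ((InnerProductSpace.toDual ℝ V).symm l)
  refine ⟨p.1, p.2, fun q hq => ?_⟩
  have h := hco.continuousLinearEquivOfBilin_apply p ⟨q, hq⟩
  rw [ContinuousLinearEquiv.apply_symm_apply, InnerProductSpace.toDual_symm_apply] at h
  exact h.symm

lemma lev_step1 {α : Type*} [MeasurableSpace α] (μ : Measure α) (φ : ℝ → ℝ≥0∞) (v : α → ℝ)
    (C F h : ℝ) (hC : 0 ≤ C) (hF : 0 ≤ F) (hh : 0 ≤ h) (E : ℝ≥0∞)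
    (hI : ∫⁻ x, ENNReal.ofReal (v x) ∂μ ≠ ⊤)
    (hE : E ≤ ENNReal.ofReal F * ∫⁻ x, ENNReal.ofReal (v x) ∂μ)
    (hlux : luxNorm φ μ v ≤ ENNReal.ofReal C * E ^ (1/2 : ℝ))
    (hk : ∀ k : ℝ, 0 < k → ∫⁻ x, φ (v x / k) ∂μ ≤ 1 →
      ∫⁻ x, ENNReal.ofReal (v x) ∂μ ≤ ENNReal.ofReal (k * h)) :
    ∫⁻ x, ENNReal.ofReal (v x) ∂μ ≤ ENNReal.ofReal (C ^ 2 * F * h ^ 2) := by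
  set I := ∫⁻ x, ENNReal.ofReal (v x) ∂μ with hIdef
  have hi0 : 0 ≤ I.toReal := ENNReal.toReal_nonneg
  have hIi : I = ENNReal.ofReal I.toReal := (ENNReal.ofReal_toReal hI).symm
  set i := I.toReal
  have hEb : ENNReal.ofReal C * E ^ (1/2 : ℝ) ≤ ENNReal.ofReal (C * √(F * i)) := by
    rw [hIi, ← ENNReal.ofReal_mul hF] at hE
    rw [ENNReal.ofReal_mul hC, Real.sqrt_eq_rpow,
      ← ENNReal.ofReal_rpow_of_nonneg (by positivity) (by norm_num)]
    gcongr
  have key : ∀ η : ℝ, C * √(F * i) < η → i ≤ η * h := by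
    intro η hη
    have hη0 : 0 < η := lt_of_le_of_lt (by positivity) hη
    have hlt : luxNorm φ μ v < ENNReal.ofReal η :=
      lt_of_le_of_lt (hlux.trans hEb) ((ENNReal.ofReal_lt_ofReal_iff hη0).2 hη)
    obtain ⟨_, ⟨k, ⟨hk0, hk1⟩, rfl⟩, hkη⟩ := sInf_lt_iff.1 hlt
    have hkη' : k < η := (ENNReal.ofReal_lt_ofReal_iff hη0).1 hkη
    have := hk k hk0 hk1
    rw [hIi, ENNReal.ofReal_le_ofReal_iff (by positivity)] at this
    exact this.trans (by gcongr)
  have h1 : i ≤ C * √(F * i) * h := by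
    refine le_of_forall_pos_le_add fun e he => ?_
    have := key (C * √(F * i) + e / (h + 1)) (by linarith [show 0 < e / (h+1) by positivity])
    have h2 : e / (h + 1) * h ≤ e := by
      rw [div_mul_eq_mul_div, div_le_iff₀ (by positivity)]; nlinarith
    nlinarith
  rw [hIi]
  apply ENNReal.ofReal_le_ofReal
  rcases hi0.eq_or_lt with h0 | h0
  · rw [← h0]; positivity
  · have h2 : i * i ≤ (C * √(F * i) * h) ^ 2 := by rw [← pow_two]; gcongr
    have h3 : (C * √(F * i) * h) ^ 2 = (C ^ 2 * F * h ^ 2) * i := by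
      rw [mul_pow, mul_pow, Real.sq_sqrt (by positivity)]; ring
    rw [h3] at h2
    exact le_of_mul_le_mul_right h2 h0

/-- splitting estimate -/
lemma lev_split {α : Type*} [MeasurableSpace α] (μ : Measure α) (φ : ℝ → ℝ≥0∞) (v : α → ℝ)
    (A : Set α) (hA : NullMeasurableSet A μ) (hv : ∀ x, x ∉ A → v x ≤ 0)
    (M κ k a : ℝ) (hM : 0 ≤ M) (hκ : 0 ≤ κ) (hk : 0 < k) (ha : 0 ≤ a)
    (hAa : μ A ≤ ENNReal.ofReal a)
    (hφ : ∀ t, M < t → ENNReal.ofReal t ≤ ENNReal.ofReal κ * φ t)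
    (hint : ∫⁻ x, φ (v x / k) ∂μ ≤ 1) :
    ∫⁻ x, ENNReal.ofReal (v x) ∂μ ≤ ENNReal.ofReal (k * (M * a + κ)) := by
  have hpt : ∀ x, ENNReal.ofReal (v x) ≤ ENNReal.ofReal k *
      (A.indicator (fun _ => ENNReal.ofReal M) x + ENNReal.ofReal κ * φ (v x / k)) := by
    intro x
    by_cases hx : x ∈ A
    · have : v x = k * (v x / k) := by field_simp
      rw [this, ENNReal.ofReal_mul hk.le, ← this]
      gcongr
      rw [indicator_of_mem hx]
      by_cases hm : M < v x / k
      · exact (hφ _ hm).trans le_add_self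
      · exact (ENNReal.ofReal_le_ofReal (not_lt.1 hm)).trans le_self_add
    · rw [ENNReal.ofReal_of_nonpos (hv x hx)]; exact zero_le
  calc ∫⁻ x, ENNReal.ofReal (v x) ∂μ ≤ ∫⁻ x, ENNReal.ofReal k *
      (A.indicator (fun _ => ENNReal.ofReal M) x + ENNReal.ofReal κ * φ (v x / k)) ∂μ :=
        lintegral_mono hpt
    _ = ENNReal.ofReal k * (ENNReal.ofReal M * μ A
          + ENNReal.ofReal κ * ∫⁻ x, φ (v x / k) ∂μ) := by
        rw [lintegral_const_mul' _ _ ENNReal.ofReal_ne_top, lintegral_add_left' ?_,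
          lintegral_const_mul' _ _ ENNReal.ofReal_ne_top, lintegral_indicator_const₀ hA]
        exact aemeasurable_const.indicator₀ hA
    _ ≤ ENNReal.ofReal k * (ENNReal.ofReal M * ENNReal.ofReal a + ENNReal.ofReal κ * 1) := by
        gcongr
    _ = _ := by
        rw [mul_one, ← ENNReal.ofReal_mul hM, ← ENNReal.ofReal_add (by positivity) hκ,
          ← ENNReal.ofReal_mul hk.le]

lemma lev_exists_J (N : ℝ) (hN : 1 < N) : ∃ J : ℕ, 1 ≤ J ∧ ∀ L : ℝ, (J : ℝ) ≤ L →
    2 * N * Real.log L ≤ L := by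
  have h := Real.isLittleO_log_id_atTop.bound (c := (2 * N)⁻¹) (by positivity)
  obtain ⟨a, ha⟩ := eventually_atTop.1 h
  refine ⟨max 1 ⌈a⌉₊, le_max_left _ _, fun L hL => ?_⟩
  have h1 : (1:ℝ) ≤ L := le_trans (by exact_mod_cast le_max_left _ _) hL
  have h2 : a ≤ L := (Nat.le_ceil a).trans (le_trans (by exact_mod_cast le_max_right _ _) hL)
  have h3 := ha L h2
  rw [Real.norm_of_nonneg (Real.log_nonneg h1), id, Real.norm_of_nonneg (by linarith),
    ← div_eq_inv_mul, le_div_iff₀ (by positivity)] at h3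
  linarith

lemma lev_phi (φ : ℝ → ℝ≥0∞) (N : ℝ) (hN : 1 < N)
    (hφN : ∀ t : ℝ, 1 ≤ t → ENNReal.ofReal (t ^ 2 * Real.log t ^ N) ≤ φ t)
    (L : ℝ) (hL1 : 1 ≤ L) (hL : 2 * N * Real.log L ≤ L) (t : ℝ)
    (ht : Real.exp (L/2) * L ^ (-N/2) < t) :
    ENNReal.ofReal t ≤ ENNReal.ofReal (4 ^ N * (Real.exp (-(L/2)) * L ^ (-N/2))) * φ t := by
  have hL0 : 0 < L := by linarith
  set M := Real.exp (L/2) * L ^ (-N/2) with hM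
  have hM0 : 0 < M := by positivity
  have hlogM : L / 4 ≤ Real.log M := by
    rw [hM, Real.log_mul (by positivity) (by positivity), Real.log_exp, Real.log_rpow hL0]
    linarith
  have hM1 : 1 ≤ M := by
    by_contra hcon
    have := Real.log_neg hM0 (not_le.1 hcon)
    linarith
  have ht1 : 1 ≤ t := by linarith
  have hlogt : L / 4 ≤ Real.log t := hlogM.trans (Real.log_le_log hM0 ht.le)
  refine le_trans ?_ (mul_le_mul_right (hφN t ht1) _)
  rw [← ENNReal.ofReal_mul (by positivity)]
  apply ENNReal.ofReal_le_ofReal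
  have e1 : (L/4) ^ N ≤ Real.log t ^ N := Real.rpow_le_rpow (by positivity) hlogt (by linarith)
  have e2 : (4:ℝ) ^ N * (Real.exp (-(L/2)) * L ^ (-N/2)) * (M * (L/4) ^ N) = 1 := by
    rw [hM, Real.div_rpow hL0.le (by norm_num), Real.exp_neg]
    have : L ^ (-N/2) * L ^ (-N/2) * L ^ N = 1 := by
      rw [← Real.rpow_add hL0, ← Real.rpow_add hL0]; ring_nf; simp
    have h4 : (4:ℝ) ^ N ≠ 0 := by positivity
    have h5 := (Real.exp_pos (L/2)).ne'
    generalize L ^ (-N/2) = y at *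
    field_simp
    linarith
  calc t = t * 1 := (mul_one t).symm
    _ = t * ((4:ℝ) ^ N * (Real.exp (-(L/2)) * L ^ (-N/2)) * (M * (L/4) ^ N)) := by rw [e2]
    _ ≤ t * ((4:ℝ) ^ N * (Real.exp (-(L/2)) * L ^ (-N/2)) * (t * Real.log t ^ N)) := by gcongr
    _ = _ := by ring

lemma lev_main (φ : ℝ → ℝ≥0∞) (N : ℝ) (hN : 1 < N)
    (hφ2 : ∀ t : ℝ, 0 ≤ t → ENNReal.ofReal (t ^ 2) ≤ φ t)
    (hφN : ∀ t : ℝ, 1 ≤ t → ENNReal.ofReal (t ^ 2 * Real.log t ^ N) ≤ φ t)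
    (C : ℝ) (hC : 0 < C) :
    ∃ K : ℝ, 0 < K ∧ ∀ {α : Type} [MeasurableSpace α] (μ : Measure α) [IsProbabilityMeasure μ]
      (u : α → ℝ) (_ : AEMeasurable u μ) (F : ℝ) (_ : 0 < F)
      (_ : ∀ c : ℝ, 0 ≤ c → ∫⁻ x, ENNReal.ofReal (max (u x - c) 0) ∂μ ≠ ⊤ ∧
        ∃ E : ℝ≥0∞, E ≤ ENNReal.ofReal F * ∫⁻ x, ENNReal.ofReal (max (u x - c) 0) ∂μ ∧
          luxNorm φ μ (fun x => max (u x - c) 0) ≤ ENNReal.ofReal C * E ^ (1/2 : ℝ)),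
      ∀ᵐ x ∂μ, u x ≤ K * F := by
  obtain ⟨J, hJ1, hJ⟩ := lev_exists_J N hN
  have hsum : Summable (fun i : ℕ => ((J + i : ℕ) : ℝ) ^ (-N)) := by
    have := (_root_.summable_nat_add_iff J).2 (Real.summable_nat_rpow.2 (show -N < -1 by linarith))
    simpa [add_comm] using this
  set Q : ℝ := C ^ 2 * (1 + 4 ^ N) ^ 2 * Real.exp 1 with hQ
  set c0 : ℝ := C ^ 2 * 2 ^ 2 * Real.exp J with hc0
  have hQ0 : 0 < Q := by positivity
  have hc00 : 0 < c0 := by positivity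
  let s : ℕ → ℝ := fun j => ∑ i ∈ Finset.range j, ((J + i : ℕ) : ℝ) ^ (-N)
  have hs0 : ∀ j, 0 ≤ s j := fun j => Finset.sum_nonneg fun i _ => by positivity
  have hsle : ∀ j, s j ≤ ∑' i : ℕ, ((J + i : ℕ) : ℝ) ^ (-N) :=
    fun j => hsum.sum_le_tsum _ fun i _ => by positivity
  refine ⟨c0 + Q * ∑' i : ℕ, ((J + i : ℕ) : ℝ) ^ (-N), ?_, ?_⟩
  · have : 0 ≤ ∑' i : ℕ, ((J + i : ℕ) : ℝ) ^ (-N) := tsum_nonneg fun i => by positivity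
    positivity
  intro α _ μ _ u hu F hF hyp
  have hmeas : ∀ c : ℝ, NullMeasurableSet {x | c < u x} μ := fun c =>
    nullMeasurableSet_lt aemeasurable_const hu
  -- general step
  have step : ∀ c d M κ a : ℝ, 0 ≤ c → c < d → 0 ≤ M → 0 ≤ κ → 0 ≤ a →
      μ {x | c < u x} ≤ ENNReal.ofReal a →
      (∀ t, M < t → ENNReal.ofReal t ≤ ENNReal.ofReal κ * φ t) →
      μ {x | d < u x} ≤ ENNReal.ofReal (C ^ 2 * F * (M * a + κ) ^ 2 / (d - c)) := by
    intro c d M κ a hc hcd hM hκ ha hμ hφ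
    obtain ⟨hI, E, hE, hlux⟩ := hyp c hc
    have h1 := lev_step1 μ φ (fun x => max (u x - c) 0) C F (M * a + κ) hC.le hF.le
      (by positivity) E hI hE hlux (fun k hk hint =>
        lev_split μ φ _ {x | c < u x} (hmeas c) (fun x hx => by
          have : u x ≤ c := not_lt.1 hx
          exact max_le (by linarith) le_rfl) M κ k a hM hκ hk ha hμ hφ hint)
    have hdc : 0 < d - c := by linarith
    have h2 : ENNReal.ofReal (d - c) * μ {x | d < u x} ≤
        ∫⁻ x, ENNReal.ofReal (max (u x - c) 0) ∂μ := by
      refine le_trans ?_ (mul_meas_ge_le_lintegral₀ (by fun_prop) (ENNReal.ofReal (d - c)))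
      gcongr with x
      intro hx
      exact ENNReal.ofReal_le_ofReal (le_max_of_le_left (by linarith))
    rw [ENNReal.ofReal_div_of_pos hdc]
    rw [ENNReal.le_div_iff_mul_le (Or.inl (by simpa using hdc)) (Or.inl ENNReal.ofReal_ne_top),
      mul_comm]
    exact h2.trans h1
  have ind : ∀ j : ℕ, μ {x | (c0 + Q * s j) * F < u x} ≤
      ENNReal.ofReal (Real.exp (-((J + j : ℕ) : ℝ))) := by
    intro j
    induction j with
    | zero =>
      refine (step 0 _ 1 1 1 le_rfl (by simp [s]; positivity) zero_le_one zero_le_one zero_le_one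
        (by simpa using prob_le_one) ?_).trans (le_of_eq ?_)
      · intro t ht
        rw [ENNReal.ofReal_one, one_mul]
        exact (ENNReal.ofReal_le_ofReal (by nlinarith)).trans (hφ2 t (by linarith))
      · congr 1
        simp only [s, hc0, Finset.range_zero, Finset.sum_empty, mul_zero, add_zero, sub_zero,
          Real.exp_neg]
        field_simp
        norm_num
    | succ j ih =>
      have hL1 : (1:ℝ) ≤ ((J + j : ℕ) : ℝ) := by exact_mod_cast (by omega)
      have hLJ : (J:ℝ) ≤ ((J + j : ℕ) : ℝ) := by exact_mod_cast (by omega)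
      set L : ℝ := ((J + j : ℕ) : ℝ) with hLdef
      have hL0 : 0 < L := by linarith
      have hs : s (j+1) = s j + L ^ (-N) := Finset.sum_range_succ _ _
      have := hs0 j
      have hdiff : (c0 + Q * s (j+1)) * F - (c0 + Q * s j) * F = Q * L ^ (-N) * F := by
        rw [hs]; ring
      have hpos : 0 < Q * L ^ (-N) * F := by positivity
      refine (step _ ((c0 + Q * s (j+1)) * F) (Real.exp (L/2) * L ^ (-N/2))
        (4 ^ N * (Real.exp (-(L/2)) * L ^ (-N/2))) (Real.exp (-L)) (by positivity)
        (by linarith) (by positivity) (by positivity) (by positivity) ih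
        (fun t ht => lev_phi φ N hN hφN L hL1 (hJ L hLJ) t ht)).trans (le_of_eq ?_)
      congr 1
      rw [hdiff]
      have e1 : Real.exp (L/2) * L ^ (-N/2) * Real.exp (-L) +
          4 ^ N * (Real.exp (-(L/2)) * L ^ (-N/2)) =
          (1 + 4 ^ N) * (Real.exp (-(L/2)) * L ^ (-N/2)) := by
        have : Real.exp (-(L/2)) = Real.exp (L/2) * Real.exp (-L) := by
          rw [← Real.exp_add]; ring_nf
        rw [this]; ring
      have e2 : (Real.exp (-(L/2)) * L ^ (-N/2)) ^ 2 = Real.exp (-L) * L ^ (-N) := by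
        rw [mul_pow, ← Real.exp_nat_mul, ← Real.rpow_mul_natCast hL0.le]
        push_cast
        ring_nf
      have e3 : Real.exp (-((J + (j+1) : ℕ) : ℝ)) = Real.exp (-L) * Real.exp (-1) := by
        rw [← Real.exp_add, hLdef]; push_cast; ring_nf
      rw [e1, mul_pow, e2, e3, hQ, Real.exp_neg 1]
      have := Real.exp_pos 1
      field_simp
  have hz : μ {x | (c0 + Q * ∑' i : ℕ, ((J + i : ℕ) : ℝ) ^ (-N)) * F < u x} = 0 := by
    refine le_antisymm (ge_of_tendsto' (x := atTop) (a := 0)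
      (f := fun j : ℕ => ENNReal.ofReal (Real.exp (-((J + j : ℕ) : ℝ)))) ?_ fun j => ?_) zero_le
    · rw [← ENNReal.ofReal_zero]
      apply ENNReal.tendsto_ofReal
      refine Real.tendsto_exp_neg_atTop_nhds_zero.comp ?_
      exact tendsto_natCast_atTop_atTop.comp (tendsto_add_atTop_nat J |>.congr fun j => by omega)
    · refine le_trans (measure_mono ?_) (ind j)
      intro x hx
      refine lt_of_le_of_lt ?_ (show _ < u x from hx)
      have := hsle j
      gcongr
  rw [ae_iff]
  simpa using hz

lemma eLpNorm_two_eq {α X : Type*} [MeasurableSpace α] [NormedAddCommGroup X] (m : Measure α)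
    (f : α → X) : eLpNorm f 2 m = (∫⁻ x, ENNReal.ofReal (‖f x‖ ^ 2) ∂m) ^ (1/2 : ℝ) := by
  rw [eLpNorm_eq_lintegral_rpow_enorm_toReal (by norm_num) (by norm_num)]
  congr 1
  · refine lintegral_congr fun x => ?_
    rw [ENNReal.ofReal_pow (norm_nonneg _), ofReal_norm]
    norm_num

lemma memLp_two_of {α X : Type*} [MeasurableSpace α] [NormedAddCommGroup X] {m : Measure α}
    {f : α → X} (hf : AEStronglyMeasurable f m) (h : ∫⁻ x, ENNReal.ofReal (‖f x‖ ^ 2) ∂m < ⊤) :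
    MemLp f 2 m := by
  refine ⟨hf, ?_⟩
  rw [eLpNorm_two_eq]
  exact ENNReal.rpow_lt_top_of_nonneg (by norm_num) h.ne

lemma lintegral_of_memLp_two {α X : Type*} [MeasurableSpace α] [NormedAddCommGroup X]
    {m : Measure α} {f : α → X} (hf : MemLp f 2 m) :
    ∫⁻ x, ENNReal.ofReal (‖f x‖ ^ 2) ∂m < ⊤ := by
  have := hf.2
  rw [eLpNorm_two_eq] at this
  exact (ENNReal.rpow_lt_top_iff_of_pos (by norm_num)).1 this

lemma tendsto_eLpNorm_two_iff {α X : Type*} [MeasurableSpace α] [NormedAddCommGroup X]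
    {m : Measure α} {f : ℕ → α → X} : Tendsto (fun k => eLpNorm (f k) 2 m) atTop (𝓝 0) ↔
    Tendsto (fun k => ∫⁻ x, ENNReal.ofReal (‖f k x‖ ^ 2) ∂m) atTop (𝓝 0) := by
  simp_rw [eLpNorm_two_eq]
  constructor
  · intro h
    have h2 := h.ennrpow_const 2
    simp_rw [← ENNReal.rpow_mul] at h2
    simpa using h2
  · intro h
    have h2 := h.ennrpow_const (1/2)
    rw [ENNReal.zero_rpow_of_pos (by norm_num)] at h2
    exact h2

def eV {n : ℕ} (G : Vec n → Vec n) : Vec n → EuclideanSpace ℝ (Fin n) :=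
  fun x => WithLp.toLp 2 (G x)

lemma eV_norm_sq {n : ℕ} (v : Vec n) :
    ‖(WithLp.toLp 2 v : EuclideanSpace ℝ (Fin n))‖ ^ 2 = sqNorm v := by
  rw [EuclideanSpace.real_norm_sq_eq]; rfl

abbrev HH {n : ℕ} (Ω : Set (Vec n)) : Type :=
  WithLp 2 (Lp ℝ 2 ((volume : Measure (Vec n)).restrict Ω) ×
    Lp (EuclideanSpace ℝ (Fin n)) 2 ((volume : Measure (Vec n)).restrict Ω))

lemma Agrad_add_ae {n : ℕ} (Bm : Vec n → Matrix (Fin n) (Fin n) ℝ) {w₁ w₂ : Vec n → ℝ}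
    {L₁ L₂ : ℝ≥0} (h₁ : LipschitzWith L₁ w₁) (h₂ : LipschitzWith L₂ w₂) (Ω : Set (Vec n)) :
    ∀ᵐ x ∂(volume.restrict Ω), Agrad Bm (w₁ + w₂) x = Agrad Bm w₁ x + Agrad Bm w₂ x := by
  apply ae_restrict_of_ae
  filter_upwards [h₁.ae_differentiableAt, h₂.ae_differentiableAt] with x hx₁ hx₂
  simp only [Agrad]
  rw [← Matrix.mulVec_add]
  congr 1
  ext i
  simp [grad, fderiv_add hx₁ hx₂]

lemma Agrad_smul {n : ℕ} (Bm : Vec n → Matrix (Fin n) (Fin n) ℝ) {w : Vec n → ℝ} (c : ℝ)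
    (x : Vec n) : Agrad Bm (c • w) x = c • Agrad Bm w x := by
  simp only [Agrad]
  rw [← Matrix.mulVec_smul]
  congr 1
  ext i
  simp [grad, fderiv_const_smul_field]

lemma IsLipCpt.add {n : ℕ} {Ω : Set (Vec n)} {w₁ w₂ : Vec n → ℝ} (h₁ : IsLipCpt Ω w₁)
    (h₂ : IsLipCpt Ω w₂) : IsLipCpt Ω (w₁ + w₂) := by
  obtain ⟨⟨L₁, hL₁⟩, c₁, s₁⟩ := h₁
  obtain ⟨⟨L₂, hL₂⟩, c₂, s₂⟩ := h₂
  exact ⟨⟨_, hL₁.add hL₂⟩, c₁.add c₂, (tsupport_add _ _).trans (union_subset s₁ s₂)⟩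

lemma IsLipCpt.smul {n : ℕ} {Ω : Set (Vec n)} {w : Vec n → ℝ} (h : IsLipCpt Ω w) (c : ℝ) :
    IsLipCpt Ω (c • w) := by
  obtain ⟨⟨L, hL⟩, cc, s⟩ := h
  refine ⟨⟨_, (lipschitzWith_smul c).comp hL⟩, cc.mono ?_, (closure_mono ?_).trans s⟩ <;>
  · intro x hx
    contrapose! hx
    simp at hx
    simp [hx]

lemma IsLipCpt.zero {n : ℕ} {Ω : Set (Vec n)} : IsLipCpt Ω (0 : Vec n → ℝ) :=
  ⟨⟨0, LipschitzWith.const 0⟩, HasCompactSupport.zero, by simp [tsupport]⟩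

def V0 {n : ℕ} (Ω : Set (Vec n)) (Bm : Vec n → Matrix (Fin n) (Fin n) ℝ) :
    Submodule ℝ (HH Ω) where
  carrier := {p | ∃ w, IsLipCpt Ω w ∧ p.fst =ᵐ[volume.restrict Ω] w ∧
    p.snd =ᵐ[volume.restrict Ω] eV (Agrad Bm w)}
  zero_mem' := by
    refine ⟨0, IsLipCpt.zero, Lp.coeFn_zero _ _ _, ?_⟩
    refine (Lp.coeFn_zero _ _ _).trans (Eventually.of_forall fun x => ?_)
    have := Agrad_smul Bm (w := 0) 0 x
    rw [zero_smul, zero_smul] at this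
    simp [eV, this]
  add_mem' := by
    rintro p q ⟨w, hw, hp1, hp2⟩ ⟨w', hw', hq1, hq2⟩
    refine ⟨w + w', hw.add hw', ?_, ?_⟩
    · filter_upwards [Lp.coeFn_add p.fst q.fst, hp1, hq1] with x h1 h2 h3
      rw [WithLp.add_fst, h1]; simp [h2, h3]
    · obtain ⟨L, hL⟩ := hw.1
      obtain ⟨L', hL'⟩ := hw'.1
      filter_upwards [Lp.coeFn_add p.snd q.snd, hp2, hq2, Agrad_add_ae Bm hL hL' Ω]
        with x h1 h2 h3 h4
      rw [WithLp.add_snd, h1]; simp [h2, h3, eV, h4]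
  smul_mem' := by
    rintro c p ⟨w, hw, hp1, hp2⟩
    refine ⟨c • w, hw.smul c, ?_, ?_⟩
    · filter_upwards [Lp.coeFn_smul c p.fst, hp1] with x h1 h2
      rw [WithLp.smul_fst, h1]; simp [h2]
    · filter_upwards [Lp.coeFn_smul c p.snd, hp2] with x h1 h2
      rw [WithLp.smul_snd, h1]; simp [h2, eV, Agrad_smul]

lemma IsLipCpt.memLp {n : ℕ} {Ω : Set (Vec n)} {w : Vec n → ℝ} (h : IsLipCpt Ω w) :
    MemLp w 2 (volume.restrict Ω) := by
  obtain ⟨⟨L, hL⟩, cc, s⟩ := h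
  exact (hL.continuous.memLp_of_hasCompactSupport cc).restrict _

lemma Agrad_measurable {n : ℕ} {Bm : Vec n → Matrix (Fin n) (Fin n) ℝ}
    (hB : BoundedLipMatrix Bm) (w : Vec n → ℝ) : Measurable (Agrad Bm w) := by
  obtain ⟨-, L, hL⟩ := hB
  refine measurable_pi_lambda _ fun i => ?_
  simp only [Agrad, Matrix.mulVec, dotProduct, grad]
  exact Finset.measurable_fun_sum _ fun j _ =>
    (hL i j).continuous.measurable.mul (measurable_fderiv_apply_const ℝ w _)

lemma eV_meas {n : ℕ} {G : Vec n → Vec n} {m : Measure (Vec n)} (h : AEMeasurable G m) :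
    AEStronglyMeasurable (eV G) m :=
  ((WithLp.measurable_toLp 2 (Fin n → ℝ)).comp_aemeasurable h).aestronglyMeasurable

lemma Agrad_memLp {n : ℕ} {Ω : Set (Vec n)} (hΩ : Bornology.IsBounded Ω)
    {Bm : Vec n → Matrix (Fin n) (Fin n) ℝ}
    (hB : BoundedLipMatrix Bm) {w : Vec n → ℝ} (h : IsLipCpt Ω w) :
    MemLp (eV (Agrad Bm w)) 2 (volume.restrict Ω) := by
  have : IsFiniteMeasure ((volume : Measure (Vec n)).restrict Ω) :=
    ⟨by simpa using hΩ.measure_lt_top⟩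
  have hm := eV_meas (m := volume.restrict Ω) (Agrad_measurable hB w).aemeasurable
  obtain ⟨⟨L, hL⟩, -⟩ := h
  obtain ⟨⟨M, hM⟩, -⟩ := hB
  have hb : ∀ x i, |Agrad Bm w x i| ≤ ∑ _j : Fin n, M * L := by
    intro x i
    simp only [Agrad, Matrix.mulVec, dotProduct, grad]
    refine (Finset.abs_sum_le_sum_abs _ _).trans (Finset.sum_le_sum fun j _ => ?_)
    rw [abs_mul]
    have h1 : |fderiv ℝ w x (Pi.single j 1)| ≤ L := by
      refine ((fderiv ℝ w x).le_opNorm _).trans ?_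
      rw [Pi.norm_single, norm_one, mul_one]
      exact norm_fderiv_le_of_lipschitz ℝ hL
    have := hM x i j
    have h0 : 0 ≤ M := (abs_nonneg _).trans this
    gcongr
  refine MemLp.of_bound hm (√(∑ _i : Fin n, (∑ _j : Fin n, M * L) ^ 2))
    (Eventually.of_forall fun x => ?_)
  apply Real.le_sqrt_of_sq_le
  rw [eV, eV_norm_sq, sqNorm]
  refine Finset.sum_le_sum fun i _ => ?_
  rw [← sq_abs]
  have := hb x i
  gcongr

lemma mem_V_of_mem {n : ℕ} {Ω : Set (Vec n)} (hΩ : Bornology.IsBounded Ω)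
    {Bm : Vec n → Matrix (Fin n) (Fin n) ℝ} (hB : BoundedLipMatrix Bm) {u : Vec n → ℝ}
    {G : Vec n → Vec n} (h : MemW12zero Ω Bm u G) :
    ∃ p ∈ (V0 Ω Bm).topologicalClosure, p.fst =ᵐ[volume.restrict Ω] u ∧
      p.snd =ᵐ[volume.restrict Ω] eV G := by
  obtain ⟨hu, hG, hu2, hG2, w, hw, hwu, hwG⟩ := h
  have mu : MemLp u 2 (volume.restrict Ω) :=
    memLp_two_of hu.aestronglyMeasurable (by simpa using hu2)
  have mG : MemLp (eV G) 2 (volume.restrict Ω) :=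
    memLp_two_of (eV_meas hG) (by simpa only [eV, eV_norm_sq] using hG2)
  refine ⟨WithLp.toLp 2 (mu.toLp, mG.toLp), ?_, mu.coeFn_toLp, mG.coeFn_toLp⟩
  change _ ∈ closure _
  refine mem_closure_of_tendsto (b := atTop) (f := fun k : ℕ => (WithLp.toLp 2
    ((hw k).memLp.toLp, (Agrad_memLp hΩ hB (hw k)).toLp) : HH Ω)) ?_
    (Eventually.of_forall fun k => ⟨w k, hw k, (hw k).memLp.coeFn_toLp,
      (Agrad_memLp hΩ hB (hw k)).coeFn_toLp⟩)
  refine ((WithLp.prod_continuous_toLp 2 _ _).tendsto _).comp (Tendsto.prodMk_nhds ?_ ?_)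
  · rw [Lp.tendsto_Lp_iff_tendsto_eLpNorm'' _ (fun k => (hw k).memLp), tendsto_eLpNorm_two_iff]
    simpa [l2dist] using hwu
  · rw [Lp.tendsto_Lp_iff_tendsto_eLpNorm'' _ (fun k => Agrad_memLp hΩ hB (hw k)),
      tendsto_eLpNorm_two_iff]
    refine hwG.congr fun k => lintegral_congr fun x => ?_
    rw [← eV_norm_sq]; rfl

lemma mem_of_mem_V {n : ℕ} {Ω : Set (Vec n)}
    {Bm : Vec n → Matrix (Fin n) (Fin n) ℝ} {p : HH Ω}
    (hp : p ∈ (V0 Ω Bm).topologicalClosure) :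
    MemW12zero Ω Bm p.fst (fun x => WithLp.ofLp (p.snd x)) := by
  have m1 := Lp.memLp p.fst
  have m2 := Lp.memLp p.snd
  refine ⟨m1.1.aemeasurable, (WithLp.measurable_ofLp 2 (Fin n → ℝ)).comp_aemeasurable
    m2.1.aemeasurable, by simpa using lintegral_of_memLp_two m1,
    by simpa only [← eV_norm_sq] using lintegral_of_memLp_two m2, ?_⟩
  obtain ⟨q, hq, hlim⟩ := mem_closure_iff_seq_limit.1 (show p ∈ closure _ from hp)
  choose w hw h1 h2 using hq
  refine ⟨w, hw, ?_, ?_⟩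
  · have := ((WithLp.fstL 2 ℝ _ _).continuous.tendsto p).comp hlim
    rw [Lp.tendsto_Lp_iff_tendsto_eLpNorm', tendsto_eLpNorm_two_iff] at this
    refine this.congr fun k => lintegral_congr_ae ?_
    filter_upwards [h1 k] with x hx
    simp [hx]
  · have := ((WithLp.sndL 2 ℝ _ _).continuous.tendsto p).comp hlim
    rw [Lp.tendsto_Lp_iff_tendsto_eLpNorm', tendsto_eLpNorm_two_iff] at this
    refine this.congr fun k => lintegral_congr_ae ?_
    filter_upwards [h2 k] with x hx
    simp only [Function.comp, Pi.sub_apply, WithLp.sndL_apply, hx, ← eV_norm_sq]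
    rfl

lemma lux_poincare {α : Type*} [MeasurableSpace α] (μ : Measure α) (φ : ℝ → ℝ≥0∞)
    (hφ : ∀ t, ENNReal.ofReal (t ^ 2) ≤ φ t) (w : α → ℝ) (C : ℝ) (hC : 0 ≤ C) (E : ℝ≥0∞)
    (hE : E ≠ ⊤) (h : luxNorm φ μ w ≤ ENNReal.ofReal C * E ^ (1/2 : ℝ)) :
    ∫⁻ x, ENNReal.ofReal ((w x) ^ 2) ∂μ ≤ ENNReal.ofReal (C ^ 2) * E := by
  have he0 : 0 ≤ E.toReal := ENNReal.toReal_nonneg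
  have hEe : E = ENNReal.ofReal E.toReal := (ENNReal.ofReal_toReal hE).symm
  set e := E.toReal
  have hEb : ENNReal.ofReal C * E ^ (1/2 : ℝ) = ENNReal.ofReal (C * √e) := by
    rw [ENNReal.ofReal_mul hC, Real.sqrt_eq_rpow,
      ← ENNReal.ofReal_rpow_of_nonneg (by positivity) (by norm_num), ← hEe]
  have key : ∀ η : ℝ, C * √e < η → ∫⁻ x, ENNReal.ofReal ((w x) ^ 2) ∂μ ≤ ENNReal.ofReal (η ^ 2) := by
    intro η hη
    have hη0 : 0 < η := lt_of_le_of_lt (by positivity) hη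
    have hlt : luxNorm φ μ w < ENNReal.ofReal η :=
      lt_of_le_of_lt (h.trans hEb.le) ((ENNReal.ofReal_lt_ofReal_iff hη0).2 hη)
    obtain ⟨_, ⟨k, ⟨hk0, hk1⟩, rfl⟩, hkη⟩ := sInf_lt_iff.1 hlt
    have hkη' : k < η := (ENNReal.ofReal_lt_ofReal_iff hη0).1 hkη
    calc ∫⁻ x, ENNReal.ofReal ((w x) ^ 2) ∂μ
        = ∫⁻ x, ENNReal.ofReal (k ^ 2) * ENNReal.ofReal ((w x / k) ^ 2) ∂μ := by
          refine lintegral_congr fun x => ?_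
          rw [← ENNReal.ofReal_mul (by positivity)]
          congr 1
          field_simp
      _ = ENNReal.ofReal (k ^ 2) * ∫⁻ x, ENNReal.ofReal ((w x / k) ^ 2) ∂μ :=
          lintegral_const_mul' _ _ ENNReal.ofReal_ne_top
      _ ≤ ENNReal.ofReal (k ^ 2) * 1 := by
          gcongr
          exact (lintegral_mono fun x => hφ _).trans hk1
      _ ≤ ENNReal.ofReal (η ^ 2) := by
          rw [mul_one]
          exact ENNReal.ofReal_le_ofReal (by gcongr)
  have hfin : ENNReal.ofReal (C ^ 2) * E = ENNReal.ofReal ((C * √e) ^ 2) := by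
    rw [hEe, ← ENNReal.ofReal_mul (by positivity), mul_pow, Real.sq_sqrt he0]
  rw [hfin]
  have hcont : Tendsto (fun η : ℝ => ENNReal.ofReal (η ^ 2)) (𝓝[>] (C * √e))
      (𝓝 (ENNReal.ofReal ((C * √e) ^ 2))) :=
    ((ENNReal.continuous_ofReal.comp (continuous_pow 2)).tendsto _).mono_left nhdsWithin_le_nhds
  refine ge_of_tendsto hcont ?_
  filter_upwards [self_mem_nhdsWithin] with η hη using key η hη

lemma inner_HH {n : ℕ} {Ω : Set (Vec n)} {p q : HH Ω} {G H : Vec n → Vec n}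
    (hp : p.snd =ᵐ[volume.restrict Ω] eV G) (hq : q.snd =ᵐ[volume.restrict Ω] eV H) :
    inner ℝ p.snd q.snd = ∫ x in Ω, ∑ i, G x i * H x i := by
  rw [L2.inner_def]
  refine integral_congr_ae ?_
  filter_upwards [hp, hq] with x h1 h2
  rw [h1, h2, PiLp.inner_apply]
  refine Finset.sum_congr rfl fun i _ => ?_
  simp [eV, mul_comm]

lemma inner_L2R {α : Type*} [MeasurableSpace α] {m : Measure α} {f g : Lp ℝ 2 m} {f' g' : α → ℝ}
    (hf : f =ᵐ[m] f') (hg : g =ᵐ[m] g') : inner ℝ f g = ∫ x, f' x * g' x ∂m := by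
  rw [L2.inner_def]
  refine integral_congr_ae ?_
  filter_upwards [hf, hg] with x h1 h2
  rw [h1, h2]; simp [mul_comm]

/-- Weak solutions may be tested with all elements of the closure. -/
lemma weak_test {n : ℕ} {Ω : Set (Vec n)} {Bm : Vec n → Matrix (Fin n) (Fin n) ℝ}
    {f u : Vec n → ℝ} {G : Vec n → Vec n} (h : IsWeakSol Ω Bm f u G)
    {p : HH Ω} (hp : p.snd =ᵐ[volume.restrict Ω] eV G)
    {fL : Lp ℝ 2 ((volume : Measure (Vec n)).restrict Ω)} (hf : fL =ᵐ[volume.restrict Ω] f)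
    (q : HH Ω) (hq : q ∈ (V0 Ω Bm).topologicalClosure) :
    inner ℝ p.snd q.snd = - inner ℝ fL q.fst := by
  have hclosed : IsClosed {q : HH Ω | inner ℝ p.snd q.snd = - inner ℝ fL q.fst} := by
    refine isClosed_eq ?_ ?_
    · exact (innerSL ℝ p.snd).continuous.comp (WithLp.sndL 2 ℝ _ _).continuous
    · exact ((innerSL ℝ fL).continuous.comp (WithLp.fstL 2 ℝ _ _).continuous).neg
  refine closure_minimal ?_ hclosed (show q ∈ closure _ from hq)
  rintro q ⟨w, hw, h1, h2⟩
  change inner ℝ p.snd q.snd = - inner ℝ fL q.fst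
  rw [inner_HH hp h2, inner_L2R hf h1]
  exact h.2 w hw

lemma weak_of_test {n : ℕ} {Ω : Set (Vec n)} (hΩ : Bornology.IsBounded Ω)
    {Bm : Vec n → Matrix (Fin n) (Fin n) ℝ} (hB : BoundedLipMatrix Bm)
    {f : Vec n → ℝ} {p : HH Ω} (hp : p ∈ (V0 Ω Bm).topologicalClosure)
    {fL : Lp ℝ 2 ((volume : Measure (Vec n)).restrict Ω)} (hf : fL =ᵐ[volume.restrict Ω] f)
    (hq : ∀ q ∈ (V0 Ω Bm).topologicalClosure, inner ℝ p.snd q.snd = - inner ℝ fL q.fst) :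
    IsWeakSol Ω Bm f p.fst (fun x => WithLp.ofLp (p.snd x)) := by
  refine ⟨mem_of_mem_V hp, fun w hw => ?_⟩
  let q : HH Ω := WithLp.toLp 2 (hw.memLp.toLp, (Agrad_memLp hΩ hB hw).toLp)
  have h1 : q.fst =ᵐ[volume.restrict Ω] w := hw.memLp.coeFn_toLp
  have h2 : q.snd =ᵐ[volume.restrict Ω] eV (Agrad Bm w) := (Agrad_memLp hΩ hB hw).coeFn_toLp
  have h := hq q ((V0 Ω Bm).le_topologicalClosure ⟨w, hw, h1, h2⟩)
  rw [inner_HH (G := fun x => WithLp.ofLp (p.snd x)) (Eventually.of_forall fun x => rfl) h2,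
    inner_L2R hf h1] at h
  exact h

lemma norm_le_of_lint {α X Y : Type*} [MeasurableSpace α] [NormedAddCommGroup X]
    [NormedAddCommGroup Y] {m : Measure α} (f : Lp X 2 m) (g : Lp Y 2 m) (C : ℝ) (hC : 0 ≤ C)
    (h : ∫⁻ x, ENNReal.ofReal (‖f x‖ ^ 2) ∂m ≤
      ENNReal.ofReal (C ^ 2) * ∫⁻ x, ENNReal.ofReal (‖g x‖ ^ 2) ∂m) : ‖f‖ ≤ C * ‖g‖ := by
  have h2 : eLpNorm f 2 m ≤ ENNReal.ofReal C * eLpNorm g 2 m := by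
    rw [eLpNorm_two_eq, eLpNorm_two_eq]
    have : ENNReal.ofReal C = ENNReal.ofReal (C ^ 2) ^ (1/2 : ℝ) := by
      rw [ENNReal.ofReal_rpow_of_nonneg (by positivity) (by norm_num), ← Real.sqrt_eq_rpow,
        Real.sqrt_sq hC]
    rw [this, ← ENNReal.mul_rpow_of_nonneg _ _ (by norm_num)]
    gcongr
  rw [Lp.norm_def, Lp.norm_def]
  have h3 := ENNReal.toReal_mono (ENNReal.mul_ne_top ENNReal.ofReal_ne_top (Lp.memLp g).2.ne) h2
  rwa [ENNReal.toReal_mul, ENNReal.toReal_ofReal hC] at h3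

/-- The energy estimate for truncations. -/
lemma energy_est {n : ℕ} {Ω : Set (Vec n)} (hΩ : Bornology.IsBounded Ω)
    {Bm : Vec n → Matrix (Fin n) (Fin n) ℝ} (hB : BoundedLipMatrix Bm)
    {f u : Vec n → ℝ} {G : Vec n → Vec n} (h : IsWeakSol Ω Bm f u G) {ε c : ℝ}
    (hε : ε = 1 ∨ ε = -1) (hfL : MemLp f 2 (volume.restrict Ω))
    (F : ℝ) (hF : 0 ≤ F) (hfF : ∀ᵐ x ∂(volume.restrict Ω), |f x| ≤ F)
    (hv : MemW12zero Ω Bm (fun x => max (ε * u x - c) 0)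
        (Set.indicator {x | c < ε * u x} (fun x => fun i => ε * G x i))) :
    (∫⁻ x in Ω, ENNReal.ofReal (max (ε * u x - c) 0)) ≠ ⊤ ∧
    (∫⁻ x in Ω, ENNReal.ofReal (sqNorm
      (Set.indicator {x | c < ε * u x} (fun x => fun i => ε * G x i) x))) ≤
      ENNReal.ofReal F * ∫⁻ x in Ω, ENNReal.ofReal (max (ε * u x - c) 0) := by
  have : IsFiniteMeasure ((volume : Measure (Vec n)).restrict Ω) :=
    ⟨by simpa using hΩ.measure_lt_top⟩
  set v : Vec n → ℝ := fun x => max (ε * u x - c) 0 with hvdef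
  set H := Set.indicator {x | c < ε * u x} (fun x => fun i => ε * G x i) with hH
  obtain ⟨p, hpV, hp1, hp2⟩ := mem_V_of_mem hΩ hB h.1
  obtain ⟨q, hqV, hq1, hq2⟩ := mem_V_of_mem hΩ hB hv
  have ht := weak_test h hp2 hfL.coeFn_toLp q hqV
  rw [inner_HH hp2 hq2, inner_L2R hfL.coeFn_toLp hq1] at ht
  have mv : MemLp v 2 (volume.restrict Ω) :=
    memLp_two_of hv.1.aestronglyMeasurable (by simpa using hv.2.2.1)
  have iv : Integrable v (volume.restrict Ω) := mv.integrable (by norm_num)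
  have v0 : ∀ x, 0 ≤ v x := fun x => le_max_right _ _
  have hε2 : ε * ε = 1 := by rcases hε with rfl | rfl <;> norm_num
  have hpt : ∀ x, sqNorm (H x) = ε * ∑ i, G x i * H x i := by
    intro x
    rw [sqNorm, Finset.mul_sum]
    refine Finset.sum_congr rfl fun i _ => ?_
    by_cases hx : x ∈ {x | c < ε * u x}
    · rw [hH, indicator_of_mem hx]; ring
    · rw [hH, indicator_of_notMem hx]; simp
  have s0 : ∀ x, 0 ≤ sqNorm (H x) := fun x => Finset.sum_nonneg fun i _ => sq_nonneg _
  have is : Integrable (fun x => sqNorm (H x)) (volume.restrict Ω) := by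
    have hm : AEMeasurable (fun x => sqNorm (H x)) (volume.restrict Ω) := by
      refine Finset.aemeasurable_fun_sum _ fun i _ => ?_
      exact ((measurable_pi_apply i).comp_aemeasurable hv.2.1).pow_const 2
    refine ⟨hm.aestronglyMeasurable, ?_⟩
    rw [hasFiniteIntegral_iff_ofReal (Eventually.of_forall s0)]
    exact hv.2.2.2.1
  have hreal : ∫ x in Ω, sqNorm (H x) ≤ F * ∫ x in Ω, v x := by
    simp_rw [hpt]
    rw [integral_const_mul, ht, ← integral_neg, ← integral_const_mul, ← integral_const_mul]
    have ifv : Integrable (fun x => f x * v x) (volume.restrict Ω) := hfL.integrable_mul mv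
    refine integral_mono_ae (ifv.neg.const_mul ε) (iv.const_mul F) ?_
    filter_upwards [hfF] with x hx
    have h1 := abs_le.1 hx
    have h2 := v0 x
    rcases hε with rfl | rfl <;> nlinarith
  refine ⟨?_, ?_⟩
  · rw [← ofReal_integral_eq_lintegral_ofReal iv (Eventually.of_forall v0)]
    exact ENNReal.ofReal_ne_top
  · rw [← ofReal_integral_eq_lintegral_ofReal iv (Eventually.of_forall v0),
      ← ofReal_integral_eq_lintegral_ofReal is (Eventually.of_forall s0),
      ← ENNReal.ofReal_mul hF]
    exact ENNReal.ofReal_le_ofReal hreal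

/-- If the Orlicz–Sobolev inequality holds on a bounded open `Ω` for a
Young function `φ` with `φ(t) ≥ t²` for `t ≥ 0` and `φ(t) ≥ t²(ln t)^N` (`N > 1`) for `t ≥ 1`,
and `(W_A^{1,2})₀(Ω)` is stable under truncations, then for every `f ∈ L^∞(Ω)` the Dirichlet
problem `∇·A∇u = f` has a weak solution `(u, ∇_A u) ∈ (W_A^{1,2})₀(Ω)`, unique as a pair,
satisfying `ess sup_Ω |u| ≤ C ‖f‖_{L^∞(Ω)}` with `C` independent of `f`. -/
theorem statement0 {n : ℕ} (Ω : Set (Vec n)) (hΩo : IsOpen Ω) (hΩb : Bornology.IsBounded Ω)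
    (Bm : Vec n → Matrix (Fin n) (Fin n) ℝ) (hBm : BoundedLipMatrix Bm)
    (φ : ℝ → ℝ≥0∞) (hφ : IsYoung φ) (N : ℝ) (hN : 1 < N)
    (hφ2 : ∀ t : ℝ, 0 ≤ t → ENNReal.ofReal (t ^ 2) ≤ φ t)
    (hφN : ∀ t : ℝ, 1 ≤ t → ENNReal.ofReal (t ^ 2 * Real.log t ^ N) ≤ φ t)
    (C₀ : ℝ)
    (hOS : ∀ w G, MemW12zero Ω Bm w G →
      luxNorm φ (normMeasure Ω) w ≤ ENNReal.ofReal C₀ *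
        (∫⁻ x, ENNReal.ofReal (sqNorm (G x)) ∂(normMeasure Ω)) ^ (1/2 : ℝ))
    (htrunc : ∀ u G, MemW12zero Ω Bm u G → ∀ ε : ℝ, ε = 1 ∨ ε = -1 → ∀ c : ℝ, 0 ≤ c →
      MemW12zero Ω Bm (fun x => max (ε * u x - c) 0)
        (Set.indicator {x | c < ε * u x} (fun x => fun i => ε * G x i))) :
    ∃ C : ℝ, 0 < C ∧ ∀ f : Vec n → ℝ, AEMeasurable f (volume.restrict Ω) →
      eLpNorm f ⊤ (volume.restrict Ω) < ⊤ →
      ∃ u G, IsWeakSol Ω Bm f u G ∧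
        (∀ u' G', IsWeakSol Ω Bm f u' G' →
          u' =ᵐ[volume.restrict Ω] u ∧ G' =ᵐ[volume.restrict Ω] G) ∧
        eLpNorm u ⊤ (volume.restrict Ω) ≤ ENNReal.ofReal C * eLpNorm f ⊤ (volume.restrict Ω) := by
  have hC1 : 0 < max C₀ 1 := lt_of_lt_of_le one_pos (le_max_right _ _)
  set C := max C₀ 1 with hCdef
  have hfinite : IsFiniteMeasure ((volume : Measure (Vec n)).restrict Ω) :=
    ⟨by simpa using hΩb.measure_lt_top⟩
  have hlux : ∀ w G, MemW12zero Ω Bm w G →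
      luxNorm φ (normMeasure Ω) w ≤ ENNReal.ofReal C *
        (∫⁻ x, ENNReal.ofReal (sqNorm (G x)) ∂(normMeasure Ω)) ^ (1/2 : ℝ) := by
    intro w G h
    refine (hOS w G h).trans ?_
    gcongr
    exact le_max_left _ _
  obtain ⟨K, hK, hlev⟩ := lev_main φ N hN hφ2 hφN C hC1
  refine ⟨K, hK, fun f hf hfb => ?_⟩
  have hφall : ∀ t, ENNReal.ofReal (t ^ 2) ≤ φ t := by
    intro t
    rcases le_total 0 t with h | h
    · exact hφ2 t h
    · rw [← hφ.even, ← neg_sq]; exact hφ2 _ (by linarith)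
  by_cases hvol : volume Ω = 0
  · have hz : (volume : Measure (Vec n)).restrict Ω = 0 := Measure.restrict_eq_zero.2 hvol
    refine ⟨0, 0, ⟨⟨aemeasurable_const, aemeasurable_const, by simp [hz], by simp [hz],
      fun _ => 0, fun _ => IsLipCpt.zero, by simp [l2dist, hz], by simp [l2distV, hz]⟩,
      fun ψ _ => by simp [hz]⟩, fun u' G' _ => ?_, by simp⟩
    rw [hz]
    exact ⟨by simp [EventuallyEq], by simp [EventuallyEq]⟩
  have hvolt : volume Ω ≠ ⊤ := hΩb.measure_lt_top.ne
  have hinv0 : (volume Ω)⁻¹ ≠ 0 := ENNReal.inv_ne_zero.2 hvolt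
  have hinvt : (volume Ω)⁻¹ ≠ ⊤ := ENNReal.inv_ne_top.2 hvol
  have hprob : IsProbabilityMeasure (normMeasure Ω) := ⟨by
    simp [normMeasure, ENNReal.inv_mul_cancel hvol hvolt]⟩
  have hnm : ∀ g : Vec n → ℝ≥0∞, ∫⁻ x, g x ∂(normMeasure Ω) =
      (volume Ω)⁻¹ * ∫⁻ x in Ω, g x := fun g => by
    rw [normMeasure, lintegral_smul_measure, smul_eq_mul]
  have hpoin : ∀ p ∈ (V0 Ω Bm).topologicalClosure, ‖p.fst‖ ≤ C * ‖p.snd‖ := by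
    intro p hp
    have hm := mem_of_mem_V hp
    have h1 := hlux _ _ hm
    have hE : ∫⁻ x, ENNReal.ofReal (sqNorm (WithLp.ofLp (p.snd x))) ∂(normMeasure Ω) ≠ ⊤ := by
      rw [hnm]
      exact ENNReal.mul_ne_top hinvt hm.2.2.2.1.ne
    have h2 := lux_poincare (normMeasure Ω) φ hφall _ C hC1.le _ hE h1
    rw [hnm, hnm, mul_left_comm, ENNReal.mul_le_mul_iff_right hinv0 hinvt] at h2
    refine norm_le_of_lint _ _ C hC1.le ?_
    simpa only [Real.norm_eq_abs, sq_abs, ← eV_norm_sq] using h2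
  have hfinf : MemLp f ⊤ (volume.restrict Ω) := ⟨hf.aestronglyMeasurable, hfb⟩
  have hf2 : MemLp f 2 (volume.restrict Ω) := hfinf.mono_exponent le_top
  obtain ⟨p, hpV, hp⟩ := laxMilgram_aux (V0 Ω Bm).topologicalClosure
    (V0 Ω Bm).isClosed_topologicalClosure C hpoin hf2.toLp
  have hsol := weak_of_test hΩb hBm hpV hf2.coeFn_toLp hp
  refine ⟨p.fst, fun x => WithLp.ofLp (p.snd x), hsol, ?_, ?_⟩
  · intro u' G' h'
    obtain ⟨q, hqV, hq1, hq2⟩ := mem_V_of_mem hΩb hBm h'.1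
    have hqt := weak_test h' hq2 hf2.coeFn_toLp
    have hd : q - p ∈ (V0 Ω Bm).topologicalClosure := Submodule.sub_mem _ hqV hpV
    have e1 := hqt _ hd
    have e2 := hp _ hd
    have e3 : inner ℝ (q - p).snd (q - p).snd = 0 := by
      conv_lhs => rw [WithLp.sub_snd, inner_sub_left, ← WithLp.sub_snd]
      rw [e1, e2, sub_self]
    have e4 : (q - p).snd = 0 := inner_self_eq_zero.1 e3
    have e5 : (q - p).fst = 0 := by
      have := hpoin _ hd
      rw [e4, norm_zero, mul_zero] at this
      exact norm_le_zero_iff.1 this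
    rw [WithLp.sub_snd, sub_eq_zero] at e4
    rw [WithLp.sub_fst, sub_eq_zero] at e5
    refine ⟨?_, ?_⟩
    · rw [← e5]; exact hq1.symm
    · rw [← e4]
      filter_upwards [hq2] with x hx
      rw [hx]; rfl
  · have hbound : ∀ F : ℝ, (eLpNorm f ⊤ (volume.restrict Ω)).toReal < F →
        eLpNorm p.fst ⊤ (volume.restrict Ω) ≤ ENNReal.ofReal K * ENNReal.ofReal F := by
      intro F hF
      have hF0 : 0 < F := lt_of_le_of_lt ENNReal.toReal_nonneg hF
      have hfF : ∀ᵐ x ∂(volume.restrict Ω), |f x| ≤ F := by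
        have := ae_le_eLpNormEssSup (f := f) (μ := volume.restrict Ω)
        filter_upwards [this] with x hx
        rw [← eLpNorm_exponent_top] at hx
        have h1 := ENNReal.toReal_mono hfb.ne hx
        rw [toReal_enorm, Real.norm_eq_abs] at h1
        linarith
      have hside : ∀ ε : ℝ, ε = 1 ∨ ε = -1 → ∀ᵐ x ∂(volume.restrict Ω), ε * p.fst x ≤ K * F := by
        intro ε hε
        have hae : ∀ᵐ x ∂(normMeasure Ω), ε * p.fst x ≤ K * F := by
          refine hlev (normMeasure Ω) (fun x => ε * p.fst x) ?_ F hF0 fun c hc => ?_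
          · exact (hsol.1.1.const_mul ε).smul_measure _
          · have htr := htrunc _ _ hsol.1 ε hε c hc
            obtain ⟨h1, h2⟩ := energy_est hΩb hBm hsol hε hf2 F hF0.le hfF htr
            refine ⟨?_, _, ?_, hlux _ _ htr⟩
            · rw [hnm]; exact ENNReal.mul_ne_top hinvt h1
            · rw [hnm, hnm, mul_left_comm]
              gcongr
        rw [normMeasure] at hae
        exact (Measure.ae_ennreal_smul_measure_iff hinv0).1 hae
      rw [← ENNReal.ofReal_mul hK.le, eLpNorm_exponent_top]
      refine eLpNormEssSup_le_of_ae_bound ?_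
      filter_upwards [hside 1 (Or.inl rfl), hside (-1) (Or.inr rfl)] with x h1 h2
      rw [Real.norm_eq_abs]
      exact abs_le.2 ⟨by linarith, by linarith⟩
    have hcont : Tendsto (fun F : ℝ => ENNReal.ofReal K * ENNReal.ofReal F)
        (𝓝[>] (eLpNorm f ⊤ (volume.restrict Ω)).toReal)
        (𝓝 (ENNReal.ofReal K * ENNReal.ofReal (eLpNorm f ⊤ (volume.restrict Ω)).toReal)) :=
      (ENNReal.Tendsto.const_mul (ENNReal.continuous_ofReal.tendsto _)
        (Or.inr ENNReal.ofReal_ne_top)).mono_left nhdsWithin_le_nhds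
    rw [ENNReal.ofReal_toReal hfb.ne] at hcont
    refine ge_of_tendsto hcont ?_
    filter_upwards [self_mem_nhdsWithin] with F hF using hbound F hF
end

section
/- Let Ω ⊂ ℝⁿ be a bounded open set and suppose the (2,2)-Sobolev inequality ∫_Ω w² dx ≤ C ∫_Ω |∇_A w|² dx holds for every pair (w, ∇_A w) ∈ (W_A^{1,2})₀(Ω). Then for every f ∈ L^∞(Ω) there exists a pair (u, ∇_A u) ∈ (W_A^{1,2})₀(Ω), unique as a pair, such that ∫_Ω ∇_A u · (B∇φ) dx = −∫_Ω f φ dx for every Lipschitz φ with compact support in Ω; that is, there exists a unique weak solution of the Dirichlet problem ∇·A∇u = f in Ω, u = 0 on ∂Ω. -/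
open MeasureTheory Filter Topology Set Matrix ENNReal NNReal

namespace DegSob

abbrev EV (n : ℕ) := EuclideanSpace ℝ (Fin n)

/-- A vector field as a Euclidean-valued field. -/
def toE {n : ℕ} (G : Vec n → Vec n) (x : Vec n) : EV n := WithLp.toLp 2 (G x)

lemma sq_eLpNorm {α F : Type*} [MeasurableSpace α] [NormedAddCommGroup F] (μ : Measure α)
    (f : α → F) : (eLpNorm f 2 μ) ^ 2 = ∫⁻ x, ENNReal.ofReal (‖f x‖ ^ 2) ∂μ := by
  have h := eLpNorm_nnreal_pow_eq_lintegral (μ := μ) (f := f) (p := 2) (by norm_num)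
  have e : ((2 : ℝ≥0) : ℝ≥0∞) = 2 := by norm_num
  rw [e] at h
  have e2 : ((2 : ℝ≥0) : ℝ) = ((2 : ℕ) : ℝ) := by norm_num
  rw [e2, ENNReal.rpow_natCast] at h
  rw [h]
  refine lintegral_congr fun x => ?_
  rw [ENNReal.rpow_natCast, ENNReal.ofReal_pow (norm_nonneg _), ofReal_norm]

lemma norm_toE {n : ℕ} (G : Vec n → Vec n) (x : Vec n) : ‖toE G x‖ ^ 2 = sqNorm (G x) := by
  simp [toE, EuclideanSpace.norm_sq_eq, sqNorm]

lemma sq_eLpNorm_toE {n : ℕ} (μ : Measure (Vec n)) (G : Vec n → Vec n) :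
    (eLpNorm (toE G) 2 μ) ^ 2 = ∫⁻ x, ENNReal.ofReal (sqNorm (G x)) ∂μ := by
  simp_rw [sq_eLpNorm, norm_toE]

lemma sq_eLpNorm_real {n : ℕ} (μ : Measure (Vec n)) (u : Vec n → ℝ) :
    (eLpNorm u 2 μ) ^ 2 = ∫⁻ x, ENNReal.ofReal ((u x) ^ 2) ∂μ := by
  rw [sq_eLpNorm]; simp

lemma tendsto_sq {a : ℕ → ℝ≥0∞} :
    Tendsto (fun k => a k ^ 2) atTop (𝓝 0) ↔ Tendsto a atTop (𝓝 0) := by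
  constructor
  · intro h
    have h2 := ((ENNReal.continuous_rpow_const (y := (1/2 : ℝ))).tendsto 0).comp h
    have e : ∀ x : ℝ≥0∞, (x ^ 2) ^ (1/2 : ℝ) = x := by
      intro x
      rw [← ENNReal.rpow_natCast, ← ENNReal.rpow_mul]; norm_num
    simp only [Function.comp_def, e] at h2
    simpa using h2
  · intro h
    have h2 := ((ENNReal.continuous_pow 2).tendsto 0).comp h
    simpa [Function.comp_def] using h2

variable {n : ℕ} {Ω : Set (Vec n)} {Bm : Vec n → Matrix (Fin n) (Fin n) ℝ}

lemma measurable_Agrad (hBm : BoundedLipMatrix Bm) (w : Vec n → ℝ) :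
    Measurable (Agrad Bm w) := by
  obtain ⟨-, L, hL⟩ := hBm
  refine measurable_pi_lambda _ fun i => ?_
  simp only [Agrad, Matrix.mulVec, dotProduct, grad]
  refine Finset.measurable_sum _ fun j _ => ?_
  exact (hL i j).continuous.measurable.mul (measurable_fderiv_apply_const ℝ w _)

lemma aesm_toE {μ : Measure (Vec n)} {G : Vec n → Vec n} (h : AEMeasurable G μ) :
    AEStronglyMeasurable (toE G) μ :=
  ((PiLp.continuous_toLp 2 (fun _ : Fin n => ℝ)).measurable.comp_aemeasurable h).aestronglyMeasurable

lemma aem_of_toE {μ : Measure (Vec n)} {G : Vec n → Vec n} (h : AEStronglyMeasurable (toE G) μ) :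
    AEMeasurable G μ :=
  (PiLp.continuous_ofLp 2 (fun _ : Fin n => ℝ)).measurable.comp_aemeasurable h.aemeasurable

lemma memLp_real {u : Vec n → ℝ} {μ : Measure (Vec n)} (h : AEMeasurable u μ)
    (h2 : (∫⁻ x, ENNReal.ofReal ((u x) ^ 2) ∂μ) < ⊤) : MemLp u 2 μ := by
  refine ⟨h.aestronglyMeasurable, ?_⟩
  rw [← sq_eLpNorm_real] at h2
  by_contra hc
  simp [not_lt_top_iff.mp hc] at h2

lemma memLp_toE {G : Vec n → Vec n} {μ : Measure (Vec n)} (h : AEMeasurable G μ)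
    (h2 : (∫⁻ x, ENNReal.ofReal (sqNorm (G x)) ∂μ) < ⊤) : MemLp (toE G) 2 μ := by
  refine ⟨aesm_toE h, ?_⟩
  rw [← sq_eLpNorm_toE] at h2
  by_contra hc
  simp [not_lt_top_iff.mp hc] at h2

lemma memLp_fun (hΩb : Bornology.IsBounded Ω) {φ : Vec n → ℝ} (h : IsLipCpt Ω φ) :
    MemLp φ 2 (volume.restrict Ω) := by
  obtain ⟨⟨L, hL⟩, hc, -⟩ := h
  exact (hL.continuous.memLp_of_hasCompactSupport hc).restrict _

lemma memLp_Agrad (hΩb : Bornology.IsBounded Ω) (hBm : BoundedLipMatrix Bm) {φ : Vec n → ℝ}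
    (h : IsLipCpt Ω φ) : MemLp (toE (Agrad Bm φ)) 2 (volume.restrict Ω) := by
  have hfin : IsFiniteMeasure (volume.restrict Ω) := ⟨by simpa using hΩb.measure_lt_top⟩
  have hm := aesm_toE (μ := volume.restrict Ω) (measurable_Agrad hBm φ).aemeasurable
  obtain ⟨⟨L, hL⟩, -, -⟩ := h
  obtain ⟨⟨M, hM⟩, -⟩ := hBm
  have hb : ∀ x i, |Agrad Bm φ x i| ≤ ∑ j : Fin n, M * (L * ‖(Pi.single j 1 : Vec n)‖) := by
    intro x i
    simp only [Agrad, Matrix.mulVec, dotProduct, grad]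
    refine (Finset.abs_sum_le_sum_abs _ _).trans (Finset.sum_le_sum fun j _ => ?_)
    rw [abs_mul]
    have h1 := hM x i j
    have h2 : |fderiv ℝ φ x (Pi.single j 1)| ≤ L * ‖(Pi.single j 1 : Vec n)‖ :=
      ((fderiv ℝ φ x).le_opNorm _).trans
        (mul_le_mul_of_nonneg_right (norm_fderiv_le_of_lipschitz ℝ hL) (norm_nonneg _))
    exact mul_le_mul h1 h2 (abs_nonneg _) ((abs_nonneg _).trans h1)
  set K := ∑ j : Fin n, M * (L * ‖(Pi.single j 1 : Vec n)‖)
  refine MemLp.of_bound hm (Real.sqrt (∑ _i : Fin n, K ^ 2)) (Eventually.of_forall fun x => ?_)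
  refine Real.le_sqrt_of_sq_le ?_
  rw [norm_toE, sqNorm]
  refine Finset.sum_le_sum fun i _ => ?_
  rw [← sq_abs]
  exact pow_le_pow_left₀ (abs_nonneg _) (hb x i) 2

lemma Agrad_add {φ ψ : Vec n → ℝ} (h : IsLipCpt Ω φ) (h' : IsLipCpt Ω ψ) :
    ∀ᵐ x ∂(volume.restrict Ω), Agrad Bm (φ + ψ) x = Agrad Bm φ x + Agrad Bm ψ x := by
  obtain ⟨⟨L, hL⟩, -, -⟩ := h
  obtain ⟨⟨L', hL'⟩, -, -⟩ := h'
  refine ae_restrict_of_ae ?_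
  filter_upwards [hL.ae_differentiableAt, hL'.ae_differentiableAt] with x hx hx'
  have : grad (φ + ψ) x = grad φ x + grad ψ x := by
    ext i; simp [grad, fderiv_add hx hx']
  rw [Agrad, this, Matrix.mulVec_add]; rfl

lemma Agrad_smul (c : ℝ) (φ : Vec n → ℝ) (x : Vec n) :
    Agrad Bm (c • φ) x = c • Agrad Bm φ x := by
  have : grad (c • φ) x = c • grad φ x := by
    ext i; simp [grad, fderiv_const_smul_field]
  rw [Agrad, this, Matrix.mulVec_smul]; rfl

lemma lipCpt_add {φ ψ : Vec n → ℝ} (h : IsLipCpt Ω φ) (h' : IsLipCpt Ω ψ) :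
    IsLipCpt Ω (φ + ψ) := by
  obtain ⟨⟨L, hL⟩, hc, hs⟩ := h
  obtain ⟨⟨L', hL'⟩, hc', hs'⟩ := h'
  exact ⟨⟨_, hL.add hL'⟩, hc.add hc', (tsupport_add φ ψ).trans (union_subset hs hs')⟩

lemma lipCpt_smul {φ : Vec n → ℝ} (c : ℝ) (h : IsLipCpt Ω φ) : IsLipCpt Ω (c • φ) := by
  obtain ⟨⟨L, hL⟩, hc, hs⟩ := h
  refine ⟨⟨_, (lipschitzWith_smul c).comp hL⟩, ?_, ?_⟩
  · exact hc.mono (Function.support_const_smul_subset c φ)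
  · exact (closure_mono (Function.support_const_smul_subset c φ)).trans hs

lemma isLipCpt_zero : IsLipCpt Ω (0 : Vec n → ℝ) := by
  refine ⟨⟨0, LipschitzWith.const 0⟩, HasCompactSupport.zero, ?_⟩
  rw [tsupport_eq_empty_iff.mpr rfl]; exact empty_subset _

abbrev HS (Ω : Set (Vec n)) :=
  WithLp 2 (Lp ℝ 2 (volume.restrict Ω) × Lp (EV n) 2 (volume.restrict Ω))

variable (Ω Bm) in
/-- The class of smooth pairs. -/
def DS : Submodule ℝ (HS Ω) where
  carrier := {h | ∃ φ, IsLipCpt Ω φ ∧ h.fst =ᵐ[volume.restrict Ω] φ ∧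
    h.snd =ᵐ[volume.restrict Ω] toE (Agrad Bm φ)}
  add_mem' := by
    rintro a b ⟨φ, hφ, h1, h2⟩ ⟨ψ, hψ, h3, h4⟩
    refine ⟨φ + ψ, lipCpt_add hφ hψ, ?_, ?_⟩
    · filter_upwards [Lp.coeFn_add a.fst b.fst, h1, h3] with x hx hx1 hx3
      rw [WithLp.add_fst, hx, Pi.add_apply, hx1, hx3]; rfl
    · filter_upwards [Lp.coeFn_add a.snd b.snd, h2, h4, Agrad_add (Bm := Bm) hφ hψ] with x hx hx1 hx3 hg
      rw [WithLp.add_snd, hx, Pi.add_apply, hx1, hx3]; simp only [toE]; rw [hg]; rfl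
  zero_mem' := by
    refine ⟨0, isLipCpt_zero, ?_, ?_⟩
    · exact Lp.coeFn_zero _ _ _
    · filter_upwards [Lp.coeFn_zero (EV n) 2 (volume.restrict Ω)] with x hx
      have := Agrad_smul (Bm := Bm) 0 0 x
      rw [zero_smul, zero_smul] at this
      rw [WithLp.zero_snd, hx, toE, this]; rfl
  smul_mem' := by
    rintro c a ⟨φ, hφ, h1, h2⟩
    refine ⟨c • φ, lipCpt_smul c hφ, ?_, ?_⟩
    · filter_upwards [Lp.coeFn_smul c a.fst, h1] with x hx hx1
      rw [WithLp.smul_fst, hx, Pi.smul_apply, hx1]; rfl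
    · filter_upwards [Lp.coeFn_smul c a.snd, h2] with x hx hx1
      rw [WithLp.smul_snd, hx, Pi.smul_apply, hx1]; simp only [toE]; rw [Agrad_smul]; rfl

lemma l2dist_eq (f g : Vec n → ℝ) :
    l2dist Ω f g = eLpNorm (f - g) 2 (volume.restrict Ω) ^ 2 := by
  rw [sq_eLpNorm_real]; rfl

lemma l2distV_eq (F G : Vec n → Vec n) :
    l2distV Ω F G = eLpNorm (toE F - toE G) 2 (volume.restrict Ω) ^ 2 := by
  have : toE F - toE G = toE (fun x i => F x i - G x i) := rfl
  rw [this, sq_eLpNorm_toE]; rfl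

lemma mem_closure_of_mem (hΩb : Bornology.IsBounded Ω) (hBm : BoundedLipMatrix Bm)
    {u : Vec n → ℝ} {G : Vec n → Vec n} (h : MemW12zero Ω Bm u G) :
    ∃ v ∈ (DS Ω Bm).topologicalClosure, v.fst =ᵐ[volume.restrict Ω] u ∧
      v.snd =ᵐ[volume.restrict Ω] toE G := by
  obtain ⟨hu, hG, hu2, hG2, w, hw, t1, t2⟩ := h
  have mu := memLp_real hu hu2
  have mG := memLp_toE hG hG2
  have mw := fun k => memLp_fun hΩb (hw k)
  have mA := fun k => memLp_Agrad hΩb hBm (hw k)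
  refine ⟨WithLp.toLp 2 (mu.toLp, mG.toLp), ?_, mu.coeFn_toLp, mG.coeFn_toLp⟩
  have T1 : Tendsto (fun k => (mw k).toLp) atTop (𝓝 mu.toLp) := by
    rw [Lp.tendsto_Lp_iff_tendsto_eLpNorm'', ← tendsto_sq]
    simpa only [l2dist_eq] using t1
  have T2 : Tendsto (fun k => (mA k).toLp) atTop (𝓝 mG.toLp) := by
    rw [Lp.tendsto_Lp_iff_tendsto_eLpNorm'', ← tendsto_sq]
    simpa only [l2distV_eq] using t2
  have T := ((WithLp.prod_continuous_toLp 2 (Lp ℝ 2 (volume.restrict Ω))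
    (Lp (EV n) 2 (volume.restrict Ω))).tendsto (mu.toLp, mG.toLp)).comp (T1.prodMk_nhds T2)
  refine mem_closure_of_tendsto T (Eventually.of_forall fun k => ?_)
  exact ⟨w k, hw k, (mw k).coeFn_toLp, (mA k).coeFn_toLp⟩

lemma mem_of_mem_closure {v : HS Ω} (hv : v ∈ (DS Ω Bm).topologicalClosure) :
    MemW12zero Ω Bm v.fst (fun x => WithLp.ofLp (v.snd x)) := by
  have m1 := Lp.memLp v.fst
  have m2 := Lp.memLp v.snd
  have e : toE (fun x => WithLp.ofLp (v.snd x)) = v.snd := rfl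
  refine ⟨m1.aestronglyMeasurable.aemeasurable, aem_of_toE (by rw [e]; exact m2.aestronglyMeasurable), ?_, ?_, ?_⟩
  · rw [← sq_eLpNorm_real]; exact ENNReal.pow_lt_top m1.2
  · rw [← sq_eLpNorm_toE]; exact ENNReal.pow_lt_top m2.2
  · obtain ⟨s, hs, ht⟩ := mem_closure_iff_seq_limit.mp hv
    choose w hw h1 h2 using hs
    have T1 := ((WithLp.fstL 2 ℝ (Lp ℝ 2 (volume.restrict Ω))
      (Lp (EV n) 2 (volume.restrict Ω))).continuous.tendsto v).comp ht
    have T2 := ((WithLp.sndL 2 ℝ (Lp ℝ 2 (volume.restrict Ω))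
      (Lp (EV n) 2 (volume.restrict Ω))).continuous.tendsto v).comp ht
    refine ⟨w, hw, ?_, ?_⟩
    · simp only [l2dist_eq]
      rw [tendsto_sq]
      refine ((Lp.tendsto_Lp_iff_tendsto_eLpNorm' _ _).mp T1).congr fun k => ?_
      exact eLpNorm_congr_ae ((h1 k).sub (ae_eq_refl _))
    · simp only [l2distV_eq]
      rw [tendsto_sq]
      refine ((Lp.tendsto_Lp_iff_tendsto_eLpNorm' _ _).mp T2).congr fun k => ?_
      exact eLpNorm_congr_ae ((h2 k).sub (ae_eq_refl _))

variable (Ω Bm) in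
noncomputable abbrev VS := (DS Ω Bm).topologicalClosure

variable (Ω Bm) in
noncomputable def pf : VS Ω Bm →L[ℝ] Lp ℝ 2 (volume.restrict Ω) :=
  (WithLp.fstL 2 ℝ _ _).comp (VS Ω Bm).subtypeL

variable (Ω Bm) in
noncomputable def ps : VS Ω Bm →L[ℝ] Lp (EV n) 2 (volume.restrict Ω) :=
  (WithLp.sndL 2 ℝ _ _).comp (VS Ω Bm).subtypeL

variable (Ω Bm) in
noncomputable def bil : VS Ω Bm →L[ℝ] VS Ω Bm →L[ℝ] ℝ :=
  (innerSL ℝ).bilinearComp (ps Ω Bm) (ps Ω Bm)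

lemma bil_apply (v w : VS Ω Bm) : bil Ω Bm v w = inner ℝ (ps Ω Bm v) (ps Ω Bm w) := rfl

lemma bil_coercive {C : ℝ}
    (hSob : ∀ w G, MemW12zero Ω Bm w G →
      (∫ x in Ω, (w x) ^ 2) ≤ C * ∫ x in Ω, sqNorm (G x)) : IsCoercive (bil Ω Bm) := by
  refine ⟨(|C| + 1)⁻¹, by positivity, fun v => ?_⟩
  have h := hSob _ _ (mem_of_mem_closure v.2)
  have e1 : ∫ x in Ω, (v.1.fst x) ^ 2 = ‖v.1.fst‖ ^ 2 := by
    rw [← real_inner_self_eq_norm_sq, L2.inner_def]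
    simp only [real_inner_self_eq_norm_sq, Real.norm_eq_abs, sq_abs]
  have e2 : ∫ x in Ω, sqNorm (WithLp.ofLp (v.1.snd x)) = ‖v.1.snd‖ ^ 2 := by
    rw [← real_inner_self_eq_norm_sq, L2.inner_def]
    simp only [real_inner_self_eq_norm_sq]
    exact integral_congr_ae (Eventually.of_forall fun x =>
      (norm_toE (fun x => WithLp.ofLp (v.1.snd x)) x).symm)
  rw [e1, e2] at h
  have e3 : ‖v‖ * ‖v‖ = ‖v.1.fst‖ ^ 2 + ‖v.1.snd‖ ^ 2 := by
    rw [← sq, ← WithLp.prod_norm_sq_eq_of_L2]; rfl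
  have e4 : bil Ω Bm v v = ‖v.1.snd‖ ^ 2 := by
    rw [bil_apply, real_inner_self_eq_norm_sq]; rfl
  rw [mul_assoc, e3, e4, inv_mul_le_iff₀ (by positivity)]
  nlinarith [le_abs_self C, sq_nonneg ‖v.1.snd‖]

lemma inner_snd {a b : Lp (EV n) 2 (volume.restrict Ω)} {F G : Vec n → Vec n}
    (ha : a =ᵐ[volume.restrict Ω] toE F) (hb : b =ᵐ[volume.restrict Ω] toE G) :
    inner ℝ a b = ∫ x in Ω, ∑ i, F x i * G x i := by
  rw [L2.inner_def]
  refine integral_congr_ae ?_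
  filter_upwards [ha, hb] with x h1 h2
  rw [h1, h2]
  simp [toE, PiLp.inner_apply, mul_comm]

lemma inner_fst {a b : Lp ℝ 2 (volume.restrict Ω)} {f g : Vec n → ℝ}
    (ha : a =ᵐ[volume.restrict Ω] f) (hb : b =ᵐ[volume.restrict Ω] g) :
    inner ℝ a b = ∫ x in Ω, f x * g x := by
  rw [L2.inner_def]
  refine integral_congr_ae ?_
  filter_upwards [ha, hb] with x h1 h2
  rw [h1, h2]
  simp [mul_comm]

/-- Two continuous functionals on the energy space agreeing on smooth pairs agree. -/
lemma ext_VS {l m : VS Ω Bm →L[ℝ] ℝ}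
    (h : ∀ d (hd : d ∈ DS Ω Bm), l ⟨d, (DS Ω Bm).le_topologicalClosure hd⟩ =
      m ⟨d, (DS Ω Bm).le_topologicalClosure hd⟩) : l = m := by
  ext v
  obtain ⟨s, hs, ht⟩ := mem_closure_iff_seq_limit.mp v.2
  have T : Tendsto (fun k => (⟨s k, (DS Ω Bm).le_topologicalClosure (hs k)⟩ : VS Ω Bm)) atTop
      (𝓝 v) := tendsto_subtype_rng.mpr ht
  refine tendsto_nhds_unique ((l.continuous.tendsto v).comp T) ?_
  refine ((m.continuous.tendsto v).comp T).congr fun k => ?_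
  exact (h _ (hs k)).symm

/-- The weak formulation as an identity of functionals on the energy space. -/
lemma weak_iff (hΩb : Bornology.IsBounded Ω) (hBm : BoundedLipMatrix Bm)
    {f u : Vec n → ℝ} {G : Vec n → Vec n} {fL : Lp ℝ 2 (volume.restrict Ω)}
    (hf : fL =ᵐ[volume.restrict Ω] f) (v : VS Ω Bm)
    (hG : v.1.snd =ᵐ[volume.restrict Ω] toE G) :
    (∀ φ : Vec n → ℝ, IsLipCpt Ω φ →
      (∫ x in Ω, ∑ i, G x i * Agrad Bm φ x i) = - ∫ x in Ω, f x * φ x) ↔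
    bil Ω Bm v = -((innerSL ℝ fL).comp (pf Ω Bm)) := by
  constructor
  · intro h
    refine ext_VS ?_
    rintro d ⟨φ, hφ, h1, h2⟩
    have := h φ hφ
    rw [← inner_snd hG h2, ← inner_fst hf h1] at this
    exact this
  · intro h φ hφ
    have mw := memLp_fun hΩb hφ
    have mA := memLp_Agrad hΩb hBm hφ
    rw [← inner_snd hG mA.coeFn_toLp, ← inner_fst hf mw.coeFn_toLp]
    have hd : (WithLp.toLp 2 (mw.toLp, mA.toLp) : HS Ω) ∈ DS Ω Bm :=
      ⟨φ, hφ, mw.coeFn_toLp, mA.coeFn_toLp⟩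
    exact congrArg (fun l : VS Ω Bm →L[ℝ] ℝ => l ⟨_, (DS Ω Bm).le_topologicalClosure hd⟩) h

end DegSob

open DegSob

/-- If the (2,2)-Sobolev inequality `∫_Ω w² ≤ C ∫_Ω |∇_A w|²` holds on
`(W_A^{1,2})₀(Ω)`, then for every `f ∈ L^∞(Ω)` there is a pair
`(u, ∇_A u) ∈ (W_A^{1,2})₀(Ω)`, unique as a pair, with
`∫_Ω ∇_A u · (B∇φ) = −∫_Ω f φ` for every compactly supported Lipschitz `φ`;
i.e. a unique weak solution of the Dirichlet problem `∇·A∇u = f`, `u|_{∂Ω} = 0`. -/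
theorem statement4 {n : ℕ} (Ω : Set (Vec n)) (hΩo : IsOpen Ω) (hΩb : Bornology.IsBounded Ω)
    (Bm : Vec n → Matrix (Fin n) (Fin n) ℝ) (hBm : BoundedLipMatrix Bm)
    (C : ℝ)
    (hSob : ∀ w G, MemW12zero Ω Bm w G →
      (∫ x in Ω, (w x) ^ 2) ≤ C * ∫ x in Ω, sqNorm (G x)) :
    ∀ f : Vec n → ℝ, AEMeasurable f (volume.restrict Ω) →
      eLpNorm f ⊤ (volume.restrict Ω) < ⊤ →
      ∃ u G, IsWeakSol Ω Bm f u G ∧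
        ∀ u' G', IsWeakSol Ω Bm f u' G' →
          u' =ᵐ[volume.restrict Ω] u ∧ G' =ᵐ[volume.restrict Ω] G := by
  intro f hf hf2
  have hfin : IsFiniteMeasure (volume.restrict Ω) := ⟨by simpa using hΩb.measure_lt_top⟩
  have mf : MemLp f 2 (volume.restrict Ω) :=
    (MemLp.mono_exponent ⟨hf.aestronglyMeasurable, hf2⟩ le_top)
  have hc := bil_coercive hSob
  have hcomp : CompleteSpace (VS Ω Bm) :=
    (DS Ω Bm).isClosed_topologicalClosure.completeSpace_coe
  set l : VS Ω Bm →L[ℝ] ℝ := -((innerSL ℝ mf.toLp).comp (pf Ω Bm)) with hl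
  set v : VS Ω Bm := hc.continuousLinearEquivOfBilin.symm
    ((InnerProductSpace.toDual ℝ (VS Ω Bm)).symm l) with hv
  have hvl : bil Ω Bm v = l := by
    ext w
    rw [← hc.continuousLinearEquivOfBilin_apply, hv, ContinuousLinearEquiv.apply_symm_apply,
      InnerProductSpace.toDual_symm_apply]
  refine ⟨v.1.fst, fun x => WithLp.ofLp (v.1.snd x), ⟨mem_of_mem_closure v.2, ?_⟩, ?_⟩
  · exact (weak_iff (u := v.1.fst) hΩb hBm mf.coeFn_toLp v (ae_eq_refl _)).mpr hvl
  · rintro u' G' ⟨hm, hw⟩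
    obtain ⟨v', hv', h1, h2⟩ := mem_closure_of_mem hΩb hBm hm
    have hb := (weak_iff (u := u') hΩb hBm mf.coeFn_toLp ⟨v', hv'⟩ h2).mp hw
    have : (⟨v', hv'⟩ : VS Ω Bm) = v := by
      apply hc.continuousLinearEquivOfBilin.injective
      refine ext_inner_right ℝ fun w => ?_
      rw [hc.continuousLinearEquivOfBilin_apply, hc.continuousLinearEquivOfBilin_apply, hvl, hb]
    have e : v' = v.1 := congrArg Subtype.val this
    rw [← e]
    refine ⟨h1.symm, ?_⟩
    filter_upwards [h2] with x hx
    rw [hx]; rfl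
end

section
/- Let Ω ⊂ ℝⁿ be a bounded open set, f ∈ L^∞(Ω), and let u be a weak solution of ∇·A∇u = f in Ω with A-gradient G = ∇_A u. Suppose the truncation pair (u₊, 1_{u>0} G) belongs to (W_A^{1,2})₀(Ω), where u₊ = max{u,0}. Then the Caccioppoli inequality ∫_{{x∈Ω : u(x)>0}} |1_{u>0} G|² dμ ≤ ‖f‖_{L^∞(Ω)} ∫_{{x∈Ω : u(x)>0}} u₊ dμ holds, where dμ = dx/|Ω|. -/
open MeasureTheory Filter Topology Set Matrix ENNReal NNReal

lemma eLpNorm_two_sq_aux {α : Type*} [MeasurableSpace α] {μ : Measure α} (f : α → ℝ) :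
    eLpNorm f 2 μ ^ (2 : ℝ) = ∫⁻ x, ENNReal.ofReal ((f x) ^ 2) ∂μ := by
  have h := eLpNorm_nnreal_pow_eq_lintegral (f := f) (μ := μ) (p := 2) (by norm_num)
  simp only [NNReal.coe_ofNat, ENNReal.coe_ofNat] at h
  rw [h]
  refine lintegral_congr fun x => ?_
  rw [← ofReal_norm_eq_enorm, ENNReal.ofReal_rpow_of_nonneg (norm_nonneg _) (by norm_num)]
  congr 1
  rw [Real.rpow_two, Real.norm_eq_abs, sq_abs]

lemma memLp_two_aux {α : Type*} [MeasurableSpace α] {μ : Measure α} {f : α → ℝ}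
    (hf : AEMeasurable f μ) (h : ∫⁻ x, ENNReal.ofReal ((f x) ^ 2) ∂μ < ⊤) : MemLp f 2 μ := by
  refine ⟨hf.aestronglyMeasurable, ?_⟩
  rw [← eLpNorm_two_sq_aux] at h
  exact (ENNReal.rpow_lt_top_iff_of_pos (by norm_num)).1 h

lemma memLp_two_aux' {α : Type*} [MeasurableSpace α] {μ : Measure α} {f g : α → ℝ}
    (hf : AEMeasurable f μ) (hg : MemLp g 2 μ)
    (h : ∫⁻ x, ENNReal.ofReal ((f x - g x) ^ 2) ∂μ < ⊤) : MemLp f 2 μ := by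
  have h1 : MemLp (fun x => f x - g x) 2 μ :=
    memLp_two_aux (hf.sub hg.aestronglyMeasurable.aemeasurable) h
  have h2 := h1.add hg
  refine h2.ae_eq (Eventually.of_forall fun x => ?_)
  simp

lemma tendsto_integral_mul_aux {α : Type*} [MeasurableSpace α] {μ : Measure α}
    {g h : α → ℝ} {hk : ℕ → α → ℝ} (hg : MemLp g 2 μ) (hh : MemLp h 2 μ)
    (hhk : ∀ k, MemLp (hk k) 2 μ)
    (ht : Tendsto (fun k => ∫⁻ x, ENNReal.ofReal ((hk k x - h x) ^ 2) ∂μ) atTop (𝓝 0)) :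
    Tendsto (fun k => ∫ x, g x * hk k x ∂μ) atTop (𝓝 (∫ x, g x * h x ∂μ)) := by
  have ht' : Tendsto (fun k => eLpNorm (hk k - h) 2 μ) atTop (𝓝 0) := by
    have := ht.ennrpow_const (1 / 2 : ℝ)
    rw [ENNReal.zero_rpow_of_pos (by norm_num)] at this
    refine this.congr fun k => ?_
    have h2 := eLpNorm_two_sq_aux (μ := μ) (hk k - h)
    simp only [Pi.sub_apply] at h2
    rw [← h2, ← ENNReal.rpow_mul]
    norm_num
  have h1 := (Lp.tendsto_Lp_iff_tendsto_eLpNorm'' hk hhk h hh).2 ht'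
  have h2 : Tendsto (fun k => inner ℝ (hg.toLp g) ((hhk k).toLp (hk k))) atTop
      (𝓝 (inner ℝ (hg.toLp g) (hh.toLp h))) := tendsto_const_nhds.inner h1
  have key : ∀ (q : α → ℝ) (hq : MemLp q 2 μ),
      inner ℝ (hg.toLp g) (hq.toLp q) = ∫ x, g x * q x ∂μ := by
    intro q hq
    rw [L2.inner_def]
    refine integral_congr_ae ?_
    filter_upwards [hg.coeFn_toLp, hq.coeFn_toLp] with x h1 h2
    rw [h1, h2]
    simp [mul_comm]
  rw [key] at h2
  exact h2.congr fun k => key _ _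

lemma sq_le_sqNorm_aux {n : ℕ} (v : Vec n) (i : Fin n) : (v i) ^ 2 ≤ sqNorm v :=
  Finset.single_le_sum (f := fun i => (v i) ^ 2) (fun j _ => sq_nonneg _) (Finset.mem_univ i)

lemma measurable_Agrad_aux {n : ℕ} {Bm : Vec n → Matrix (Fin n) (Fin n) ℝ}
    (hBm : BoundedLipMatrix Bm) (w : Vec n → ℝ) (i : Fin n) :
    Measurable (fun x => Agrad Bm w x i) := by
  obtain ⟨L, hL⟩ := hBm.2
  simp only [Agrad, grad, Matrix.mulVec, dotProduct]
  refine Finset.measurable_sum _ fun j _ => ?_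
  exact (hL i j).continuous.measurable.mul (measurable_fderiv_apply_const ℝ w _)

/-- **Caccioppoli inequality.** If `u` is a weak solution of `∇·A∇u = f` in `Ω`
with `f ∈ L^∞(Ω)` and `∇_A u = G`, and the truncation pair `(u₊, 1_{u>0} G)` belongs to
`(W_A^{1,2})₀(Ω)`, then
`∫_{u>0} |1_{u>0} G|² dμ ≤ ‖f‖_{L^∞(Ω)} ∫_{u>0} u₊ dμ`, where `dμ = dx/|Ω|`. -/
theorem statement6 {n : ℕ} (Ω : Set (Vec n)) (hΩo : IsOpen Ω) (hΩb : Bornology.IsBounded Ω)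
    (Bm : Vec n → Matrix (Fin n) (Fin n) ℝ) (hBm : BoundedLipMatrix Bm)
    (f : Vec n → ℝ) (hfm : AEMeasurable f (volume.restrict Ω))
    (hf : eLpNorm f ⊤ (volume.restrict Ω) < ⊤)
    (u : Vec n → ℝ) (G : Vec n → Vec n)
    (hu : IsWeakSol Ω Bm f u G)
    (htr : MemW12zero Ω Bm (fun x => max (u x) 0) (Set.indicator {x | 0 < u x} G)) :
    (∫⁻ x in {x | 0 < u x}, ENNReal.ofReal (sqNorm (Set.indicator {x | 0 < u x} G x))
        ∂(normMeasure Ω)) ≤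
      eLpNorm f ⊤ (volume.restrict Ω) *
        ∫⁻ x in {x | 0 < u x}, ENNReal.ofReal (max (u x) 0) ∂(normMeasure Ω) := by
  obtain ⟨⟨hum, hGm, hu2, hG2, -⟩, hweak⟩ := hu
  obtain ⟨hvm, hHm, hv2, hH2, w, hw, hwt, hwT⟩ := htr
  have hfin : IsFiniteMeasure (volume.restrict Ω) :=
    ⟨by rw [Measure.restrict_apply_univ]; exact hΩb.measure_lt_top⟩
  set P : Set (Vec n) := {x | 0 < u x} with hP
  set H : Vec n → Vec n := P.indicator G with hH
  set μ := volume.restrict Ω with hμ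
  set v : Vec n → ℝ := fun x => max (u x) 0 with hv
  have hPm : NullMeasurableSet P μ := nullMeasurableSet_lt aemeasurable_const hum
  have hv0 : ∀ x, 0 ≤ v x := fun x => le_max_right _ _
  -- main inequality
  have main : ∫⁻ x, ENNReal.ofReal (sqNorm (H x)) ∂μ ≤
      eLpNorm f ⊤ μ * ∫⁻ x, ENNReal.ofReal (v x) ∂μ := by
    have hvL : MemLp v 2 μ := memLp_two_aux hvm hv2
    have hcoord : ∀ (K : Vec n → Vec n), AEMeasurable K μ →
        (∫⁻ x, ENNReal.ofReal (sqNorm (K x)) ∂μ) < ⊤ → ∀ i, MemLp (fun x => K x i) 2 μ := by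
      intro K hK hK2 i
      refine memLp_two_aux ((measurable_pi_apply i).comp_aemeasurable hK) (lt_of_le_of_lt ?_ hK2)
      exact lintegral_mono fun x => ENNReal.ofReal_le_ofReal (sq_le_sqNorm_aux (K x) i)
    have hGL := hcoord G hGm hG2
    have hHL := hcoord H hHm hH2
    have hfT : MemLp f ⊤ μ := ⟨hfm.aestronglyMeasurable, hf⟩
    have hfL : MemLp f 2 μ := hfT.mono_exponent le_top
    obtain ⟨N, hN⟩ := eventually_atTop.1
      ((hwt.eventually (gt_mem_nhds ENNReal.zero_lt_top)).and
        (hwT.eventually (gt_mem_nhds ENNReal.zero_lt_top)))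
    have hwt' := (tendsto_add_atTop_iff_nat N).2 hwt
    have hwT' := (tendsto_add_atTop_iff_nat N).2 hwT
    have hwL : ∀ k, MemLp (w (k + N)) 2 μ := fun k =>
      memLp_two_aux' (by
        obtain ⟨L, hL⟩ := (hw (k + N)).1
        exact hL.continuous.measurable.aemeasurable) hvL (hN (k + N) (by omega)).1
    have hle : ∀ k i, ∫⁻ x, ENNReal.ofReal ((Agrad Bm (w (k + N)) x i - H x i) ^ 2) ∂μ ≤
        l2distV Ω (fun x => Agrad Bm (w (k + N)) x) H := fun k i =>
      lintegral_mono fun x => ENNReal.ofReal_le_ofReal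
        (sq_le_sqNorm_aux (fun i => Agrad Bm (w (k + N)) x i - H x i) i)
    have hAL : ∀ i k, MemLp (fun x => Agrad Bm (w (k + N)) x i) 2 μ := fun i k =>
      memLp_two_aux' (measurable_Agrad_aux hBm _ i).aemeasurable (hHL i)
        (lt_of_le_of_lt (hle k i) (hN (k + N) (by omega)).2)
    have t1 : Tendsto (fun k => ∫ x, f x * w (k + N) x ∂μ) atTop (𝓝 (∫ x, f x * v x ∂μ)) :=
      tendsto_integral_mul_aux hfL hvL hwL hwt'
    have t2 : ∀ i, Tendsto (fun k => ∫ x, G x i * Agrad Bm (w (k + N)) x i ∂μ) atTop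
        (𝓝 (∫ x, G x i * H x i ∂μ)) := fun i =>
      tendsto_integral_mul_aux (hGL i) (hHL i) (hAL i)
        (tendsto_of_tendsto_of_tendsto_of_le_of_le tendsto_const_nhds hwT'
          (fun _ => zero_le) (fun k => hle k i))
    have t3 := tendsto_finsetSum Finset.univ (fun i _ => t2 i)
    have heq : ∑ i, ∫ x, G x i * H x i ∂μ = - ∫ x, f x * v x ∂μ := by
      refine tendsto_nhds_unique t3 (t1.neg.congr fun k => ?_)
      rw [← hweak _ (hw (k + N)), integral_finsetSum]
      intro i _
      exact (hGL i).integrable_mul (hAL i k)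
    have hGH : ∀ x, ∑ i, G x i * H x i = sqNorm (H x) := by
      intro x
      unfold sqNorm
      refine Finset.sum_congr rfl fun i _ => ?_
      by_cases hx : x ∈ P
      · rw [hH, Set.indicator_of_mem hx, sq]
      · rw [hH, Set.indicator_of_notMem hx]; simp
    have hint : ∀ i ∈ (Finset.univ : Finset (Fin n)), Integrable (fun x => G x i * H x i) μ :=
      fun i _ => (hGL i).integrable_mul (hHL i)
    have hint' : Integrable (fun x => sqNorm (H x)) μ := by
      simp_rw [← hGH]
      exact integrable_finsetSum _ hint
    rw [← integral_finsetSum _ hint] at heq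
    simp_rw [hGH] at heq
    have hvI : Integrable v μ := hvL.integrable (by norm_num)
    have hbound : - ∫ x, f x * v x ∂μ ≤ (eLpNorm f ⊤ μ).toReal * ∫ x, v x ∂μ := by
      rw [← integral_neg, ← integral_const_mul]
      refine integral_mono_ae (hfL.integrable_mul hvL).neg (hvI.const_mul _) ?_
      have hb := ae_le_eLpNormEssSup (f := f) (μ := μ)
      filter_upwards [hb] with x hx
      rw [← eLpNorm_exponent_top] at hx
      have h1 : |f x| ≤ (eLpNorm f ⊤ μ).toReal := by
        have := ENNReal.toReal_mono hf.ne hx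
        simpa using this
      have h2 := neg_abs_le (f x)
      have h3 := hv0 x
      show -(f x * v x) ≤ (eLpNorm f ⊤ μ).toReal * v x
      nlinarith
    rw [← ofReal_integral_eq_lintegral_ofReal hint'
        (Eventually.of_forall fun x => Finset.sum_nonneg fun i _ => sq_nonneg _),
      ← ofReal_integral_eq_lintegral_ofReal hvI (Eventually.of_forall hv0),
      ← ENNReal.ofReal_toReal hf.ne, ← ENNReal.ofReal_mul ENNReal.toReal_nonneg, heq]
    exact ENNReal.ofReal_le_ofReal hbound
  have hvP : ∫⁻ x in P, ENNReal.ofReal (v x) ∂μ = ∫⁻ x, ENNReal.ofReal (v x) ∂μ := by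
    rw [← lintegral_indicator₀ hPm]
    refine lintegral_congr fun x => ?_
    by_cases hx : x ∈ P
    · rw [Set.indicator_of_mem hx]
    · rw [Set.indicator_of_notMem hx]
      have : v x = 0 := max_eq_right (not_lt.1 hx)
      rw [this, ENNReal.ofReal_zero]
  unfold normMeasure
  rw [Measure.restrict_smul, lintegral_smul_measure, lintegral_smul_measure, hvP, smul_eq_mul,
    smul_eq_mul, mul_left_comm]
  gcongr
  exact (setLIntegral_le_lintegral _ _).trans main
end
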